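/- Let p, q, c, e, i be integers with 1 ≤ c ≤ min{p,q}, 0 ≤ e ≤ p-c and 0 ≤ i ≤ q-c. Then the number of partitions in NC^B(p,q) that have connectivity equal to c, have e exterior pairs of blocks, and have i interior pairs of blocks is exactly 2c · C(p,e) · C(p,e+c) · C(q,i) · C(q,i+c). -/

import Mathlib

/-!  Common setup: annular non-crossing partitions of type B, following
Goulden–Nica–Oancea, "Enumerative properties of NC^(B)(p,q)". -/

/-- The underlying set `{±1, …, ±n}`, realized inside `ℤ`. -/
def signedSet (n : ℕ) : Set ℤ := {x : ℤ | x ≠ 0 ∧ |x| ≤ (n : ℤ)}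

/-- Membership in the hyperoctahedral group `B_n`, realized as the permutations of `ℤ`
that commute with negation and fix every point outside `{±1, …, ±n}`. -/
def inB (n : ℕ) (π : Equiv.Perm ℤ) : Prop :=
  (∀ x : ℤ, π (-x) = -(π x)) ∧ ∀ x : ℤ, x ∉ signedSet n → π x = x

/-- The set of generators of `B_n`:
`(i,j)(-i,-j)`, `(i,-j)(-i,j)` for `1 ≤ i ≠ j ≤ n`, and `(i,-i)` for `1 ≤ i ≤ n`. -/
def genB (n : ℕ) : Set (Equiv.Perm ℤ) :=
  {π | (∃ i j : ℤ, 1 ≤ i ∧ i ≤ (n : ℤ) ∧ 1 ≤ j ∧ j ≤ (n : ℤ) ∧ i ≠ j ∧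
          π = Equiv.swap i j * Equiv.swap (-i) (-j)) ∨
       (∃ i j : ℤ, 1 ≤ i ∧ i ≤ (n : ℤ) ∧ 1 ≤ j ∧ j ≤ (n : ℤ) ∧ i ≠ j ∧
          π = Equiv.swap i (-j) * Equiv.swap (-i) j) ∨
       (∃ i : ℤ, 1 ≤ i ∧ i ≤ (n : ℤ) ∧ π = Equiv.swap i (-i))}

/-- The length function `ℓ_B` on `B_n`: the least `k` such that `τ` is a product of `k`
generators from `genB n` (the empty product being the identity). -/
noncomputable def lenB (n : ℕ) (τ : Equiv.Perm ℤ) : ℕ :=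
  sInf {k : ℕ | ∃ l : List (Equiv.Perm ℤ),
    l.length = k ∧ (∀ g ∈ l, g ∈ genB n) ∧ l.prod = τ}

/-- The partial order on `B_n`:  `τ ≤ σ` iff `ℓ_B(σ) = ℓ_B(τ) + ℓ_B(τ⁻¹σ)`. -/
def leB (n : ℕ) (τ σ : Equiv.Perm ℤ) : Prop :=
  lenB n σ = lenB n τ + lenB n (τ⁻¹ * σ)

/-- The permutation `γ_{p,q} = (1,…,p,-1,…,-p)(p+1,…,p+q,-(p+1),…,-(p+q))`. -/
def gammaPQ (p q : ℕ) : Equiv.Perm ℤ :=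
  (((List.range p).map fun i => ((i : ℤ) + 1)) ++
      ((List.range p).map fun i => -((i : ℤ) + 1))).formPerm *
    (((List.range q).map fun i => ((p : ℤ) + (i : ℤ) + 1)) ++
      ((List.range q).map fun i => -((p : ℤ) + (i : ℤ) + 1))).formPerm

/-- The long cycle `γ_n = (1,…,n,-1,…,-n)` of `B_n` (disc case). -/
def gammaDisc (n : ℕ) : Equiv.Perm ℤ :=
  (((List.range n).map fun i => ((i : ℤ) + 1)) ++
    ((List.range n).map fun i => -((i : ℤ) + 1))).formPerm

/-- The annular non-crossing permutations of type B: `S^B_nc(p,q) = [ε, γ_{p,q}] ⊆ B_{p+q}`. -/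
def SncB (p q : ℕ) : Set (Equiv.Perm ℤ) :=
  {τ | inB (p + q) τ ∧ leB (p + q) τ (gammaPQ p q)}

/-- The orbit of `x` under the permutation `τ`. -/
def permOrbit (τ : Equiv.Perm ℤ) (x : ℤ) : Set ℤ := {y | ∃ m : ℤ, (τ ^ m) x = y}

/-- The partition `Ω(τ)` of `{±1,…,±n}` into orbits of `τ`. -/
def orbitsOn (n : ℕ) (τ : Equiv.Perm ℤ) : Set (Set ℤ) :=
  {A | ∃ x ∈ signedSet n, A = permOrbit τ x}

/-- The negation `-A` of a set `A ⊆ ℤ`. -/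
def negSet (A : Set ℤ) : Set ℤ := {x | -x ∈ A}

/-- The partition `Ω̃(τ)`, obtained from `Ω(τ)` by merging all inversion-invariant orbits
(orbits `A` with `A = -A`) into a single block. -/
def omegaTilde (n : ℕ) (τ : Equiv.Perm ℤ) : Set (Set ℤ) :=
  {A | A ∈ orbitsOn n τ ∧ negSet A ≠ A} ∪
    {B | B = ⋃₀ {A | A ∈ orbitsOn n τ ∧ negSet A = A} ∧ B.Nonempty}

/-- The annular non-crossing partitions of type B: `NC^B(p,q) = {Ω̃(τ) : τ ∈ S^B_nc(p,q)}`. -/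
def NCB (p q : ℕ) : Set (Set (Set ℤ)) :=
  {π | ∃ τ ∈ SncB p q, π = omegaTilde (p + q) τ}

/-- The type B non-crossing partitions of the disc: `NC^B(n) = {Ω̃(τ) : τ ∈ B_n, τ ≤ γ_n}`. -/
def NCBdisc (n : ℕ) : Set (Set (Set ℤ)) :=
  {π | ∃ τ, inB n τ ∧ leB n τ (gammaDisc n) ∧ π = omegaTilde n τ}

/-- Reverse refinement order on partitions: every block of `π` is contained in a block of `ρ`. -/
def refines (π ρ : Set (Set ℤ)) : Prop := ∀ A ∈ π, ∃ B ∈ ρ, A ⊆ B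

/-- The rank of a partition of `{±1,…,±n}`:
`n` minus half the number of blocks `A` with `A ≠ -A`. -/
noncomputable def rankNCB (n : ℕ) (π : Set (Set ℤ)) : ℕ :=
  n - {A | A ∈ π ∧ negSet A ≠ A}.ncard / 2

/-- The inner point set `{±(p+1), …, ±(p+q)}`. -/
def innerSet (p q : ℕ) : Set ℤ := {x : ℤ | (p : ℤ) < |x| ∧ |x| ≤ (p : ℤ) + (q : ℤ)}

/-- The connectivity of `π ∈ NC^B(p,q)`: half the number of blocks `A` with `A ≠ -A`
meeting both `{±1,…,±p}` and `{±(p+1),…,±(p+q)}`. -/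
noncomputable def connectivity (p q : ℕ) (π : Set (Set ℤ)) : ℕ :=
  {A | A ∈ π ∧ negSet A ≠ A ∧ (A ∩ signedSet p).Nonempty ∧
    (A ∩ innerSet p q).Nonempty}.ncard / 2

/-- The number of exterior pairs of blocks `{A, -A}` (with `A ≠ -A`, `A ⊆ {±1,…,±p}`). -/
noncomputable def extPairs (p : ℕ) (π : Set (Set ℤ)) : ℕ :=
  {A | A ∈ π ∧ negSet A ≠ A ∧ A ⊆ signedSet p}.ncard / 2

/-- The number of interior pairs of blocks `{A, -A}`
(with `A ≠ -A`, `A ⊆ {±(p+1),…,±(p+q)}`). -/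
noncomputable def intPairs (p q : ℕ) (π : Set (Set ℤ)) : ℕ :=
  {A | A ∈ π ∧ negSet A ≠ A ∧ A ⊆ innerSet p q}.ncard / 2

/-- The minimum `0̂` of `NC^B(p,q)` (with `n = p+q`): the partition into singletons. -/
def botNCB (n : ℕ) : Set (Set ℤ) := {A | ∃ x ∈ signedSet n, A = {x}}

/-- The maximum `1̂` of `NC^B(p,q)` (with `n = p+q`): the partition with a single block. -/
def topNCB (n : ℕ) : Set (Set ℤ) := {signedSet n}

/-- The orbit of `x` under the subgroup generated by `{τ, γ}`. -/
def jointOrbit (τ γ : Equiv.Perm ℤ) (x : ℤ) : Set ℤ :=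
  {y | ∃ g ∈ Subgroup.closure ({τ, γ} : Set (Equiv.Perm ℤ)), g x = y}

/-- The orbits on `{±1,…,±n}` of the subgroup generated by `{τ, γ}`. -/
def jointOrbitsOn (n : ℕ) (τ γ : Equiv.Perm ℤ) : Set (Set ℤ) :=
  {Y | ∃ x ∈ signedSet n, Y = jointOrbit τ γ x}


open Module

def Vn (n : ℕ) : Submodule ℚ (ℤ → ℚ) where
  carrier := {v | (∀ x, v (-x) = - v x) ∧ ∀ x, x ∉ signedSet n → v x = 0}
  add_mem' := by
    rintro a b ⟨h1, h2⟩ ⟨h3, h4⟩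
    refine ⟨fun x => ?_, fun x hx => ?_⟩
    · simp only [Pi.add_apply, h1, h3]; ring
    · simp [h2 x hx, h4 x hx]
  zero_mem' := by simp
  smul_mem' := by
    rintro c a ⟨h1, h2⟩
    refine ⟨fun x => ?_, fun x hx => ?_⟩
    · simp [h1]
    · simp [h2 x hx]

def FV (n : ℕ) (w : Equiv.Perm ℤ) : Submodule ℚ (ℤ → ℚ) where
  carrier := {v | v ∈ Vn n ∧ ∀ x, v (w x) = v x}
  add_mem' := by
    rintro a b ⟨h1, h2⟩ ⟨h3, h4⟩
    exact ⟨add_mem h1 h3, fun x => by simp [h2, h4]⟩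
  zero_mem' := ⟨zero_mem _, by simp⟩
  smul_mem' := by
    rintro c a ⟨h1, h2⟩
    exact ⟨Submodule.smul_mem _ _ h1, fun x => by simp [h2]⟩

theorem mem_FV {n w v} : v ∈ FV n w ↔ v ∈ Vn n ∧ ∀ x, v (w x) = v x := Iff.rfl
theorem mem_Vn {n v} : v ∈ Vn n ↔ (∀ x, v (-x) = - v x) ∧ ∀ x, x ∉ signedSet n → v x = 0 := Iff.rfl

theorem FV_le_Vn (n w) : FV n w ≤ Vn n := fun _ h => h.1

instance (n : ℕ) : FiniteDimensional ℚ (Vn n) := by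
  let f : Vn n →ₗ[ℚ] (Finset.Icc (-(n:ℤ)) n → ℚ) :=
    { toFun := fun v x => v.1 x
      map_add' := fun a b => rfl
      map_smul' := fun a b => rfl }
  refine FiniteDimensional.of_injective f ?_
  intro a b hab
  apply Subtype.ext
  funext x
  by_cases hx : x ∈ Finset.Icc (-(n:ℤ)) n
  · exact congrFun hab ⟨x, hx⟩
  · have : x ∉ signedSet n := by
      intro h
      apply hx
      rw [Finset.mem_Icc]
      exact abs_le.1 h.2
    rw [a.2.2 x this, b.2.2 x this]

instance (n : ℕ) (w) : FiniteDimensional ℚ (FV n w) :=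
  Submodule.finiteDimensional_of_le (FV_le_Vn n w)

noncomputable def dV (n : ℕ) (w : Equiv.Perm ℤ) : ℕ := finrank ℚ (FV n w)
noncomputable def DV (n : ℕ) : ℕ := finrank ℚ (Vn n)

theorem dV_le (n w) : dV n w ≤ DV n := Submodule.finrank_mono (FV_le_Vn n w)

theorem dV_one (n) : dV n 1 = DV n := by
  have : FV n 1 = Vn n := le_antisymm (FV_le_Vn n 1) (fun v h => ⟨h, fun x => rfl⟩)
  rw [dV, this, DV]

theorem FV_inf_le (n a b) : FV n a ⊓ FV n b ≤ FV n (a * b) := by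
  rintro v ⟨h1, h2⟩
  exact ⟨h1.1, fun x => by rw [Equiv.Perm.mul_apply, h1.2, h2.2]⟩

theorem dV_inf (n a b) : dV n a + dV n b ≤ DV n + finrank ℚ (FV n a ⊓ FV n b : Submodule ℚ _) := by
  have h := Submodule.finrank_sup_add_finrank_inf_eq (FV n a) (FV n b)
  have h2 : finrank ℚ (FV n a ⊔ FV n b : Submodule ℚ _) ≤ DV n :=
    Submodule.finrank_mono (sup_le (FV_le_Vn n a) (FV_le_Vn n b))
  unfold dV
  omega

theorem dV_mul (n a b) : dV n a + dV n b ≤ DV n + dV n (a * b) := by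
  have h := dV_inf n a b
  have := Submodule.finrank_mono (FV_inf_le n a b)
  unfold dV at *
  omega

/-- reflections -/
def rf (a b : ℤ) : Equiv.Perm ℤ :=
  if b = -a then Equiv.swap a b else Equiv.swap a b * Equiv.swap (-a) (-b)

theorem rf_left (a b : ℤ) (ha : a ≠ 0) : rf a b a = b := by
  unfold rf; split_ifs with h1
  · simp
  · simp only [Equiv.Perm.mul_apply, Equiv.swap_apply_def]; split_ifs <;> omega

theorem rf_right (a b : ℤ) (hb : b ≠ 0) : rf a b b = a := by
  unfold rf; split_ifs with h1
  · simp
  · simp only [Equiv.Perm.mul_apply, Equiv.swap_apply_def]; split_ifs <;> omega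

theorem rf_odd (a b x : ℤ) (ha : a ≠ 0) (hb : b ≠ 0) : rf a b (-x) = - rf a b x := by
  unfold rf; split_ifs with h1
  · subst h1; simp only [Equiv.swap_apply_def]; split_ifs <;> omega
  · simp only [Equiv.Perm.mul_apply, Equiv.swap_apply_def]; split_ifs <;> omega

theorem rf_ne (a b x : ℤ) (h1 : x ≠ a) (h2 : x ≠ b) (h3 : x ≠ -a) (h4 : x ≠ -b) :
    rf a b x = x := by
  unfold rf; split_ifs with h
  · exact Equiv.swap_apply_of_ne_of_ne h1 h2
  · rw [Equiv.Perm.mul_apply, Equiv.swap_apply_of_ne_of_ne h3 h4,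
      Equiv.swap_apply_of_ne_of_ne h1 h2]

theorem rf_invol (a b : ℤ) (ha : a ≠ 0) (hb : b ≠ 0) : rf a b * rf a b = 1 := by
  ext x
  unfold rf; split_ifs with h1
  · simp
  · simp only [Equiv.Perm.mul_apply, Equiv.swap_apply_def, Equiv.Perm.one_apply]
    split_ifs <;> omega

theorem ss_neg {n : ℕ} {x : ℤ} : -x ∈ signedSet n ↔ x ∈ signedSet n := by
  simp [signedSet]

theorem ss_ne {n : ℕ} {x : ℤ} (h : x ∈ signedSet n) : x ≠ 0 := h.1

theorem inB_mul {n a b} (ha : inB n a) (hb : inB n b) : inB n (a * b) :=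
  ⟨fun x => by simp [hb.1, ha.1], fun x hx => by simp [hb.2 x hx, ha.2 x hx]⟩

theorem inB_one {n} : inB n 1 := ⟨fun _ => rfl, fun _ _ => rfl⟩

theorem inB_inv {n a} (ha : inB n a) : inB n a⁻¹ := by
  refine ⟨fun x => ?_, fun x hx => ?_⟩
  · rw [Equiv.Perm.inv_eq_iff_eq, ha.1]; simp
  · rw [Equiv.Perm.inv_eq_iff_eq, ha.2 x hx]

theorem inB_rf {n a b} (ha : a ∈ signedSet n) (hb : b ∈ signedSet n) : inB n (rf a b) := by
  refine ⟨fun x => rf_odd a b x ha.1 hb.1, fun x hx => rf_ne _ _ _ ?_ ?_ ?_ ?_⟩ <;>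
    rintro rfl <;> simp_all [ss_neg]

theorem inB_mem {n a x} (ha : inB n a) (hx : x ∈ signedSet n) : a x ∈ signedSet n := by
  by_contra h
  have := ha.2 _ h
  have := a.injective this
  rw [this] at h; exact h hx

theorem pos_or_neg {n : ℕ} {a : ℤ} (ha : a ∈ signedSet n) :
    ∃ i : ℤ, 1 ≤ i ∧ i ≤ n ∧ (a = i ∨ a = -i) := by
  obtain ⟨h0, h1⟩ := ha
  rw [abs_le] at h1
  rcases lt_or_gt_of_ne h0 with h | h
  · exact ⟨-a, by omega, by omega, by omega⟩
  · exact ⟨a, by omega, by omega, by omega⟩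

theorem rf_mem_genB {n a b} (ha : a ∈ signedSet n) (hb : b ∈ signedSet n) (hab : a ≠ b) :
    rf a b ∈ genB n := by
  obtain ⟨i, hi1, hi2, hi⟩ := pos_or_neg ha
  obtain ⟨j, hj1, hj2, hj⟩ := pos_or_neg hb
  by_cases h : b = -a
  · right; right
    refine ⟨i, hi1, hi2, ?_⟩
    rw [rf, if_pos h, h]
    rcases hi with rfl | rfl
    · rfl
    · rw [Equiv.swap_comm]; simp
  · have hij : i ≠ j := by rintro rfl; omega
    have hc : Equiv.swap i j * Equiv.swap (-i) (-j) = Equiv.swap (-i) (-j) * Equiv.swap i j := by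
      ext x; simp only [Equiv.Perm.mul_apply, Equiv.swap_apply_def]; split_ifs <;> omega
    have hc2 : Equiv.swap i (-j) * Equiv.swap (-i) j = Equiv.swap (-i) j * Equiv.swap i (-j) := by
      ext x; simp only [Equiv.Perm.mul_apply, Equiv.swap_apply_def]; split_ifs <;> omega
    rw [rf, if_neg h]
    rcases hi with rfl | rfl <;> rcases hj with rfl | rfl
    · left; exact ⟨a, b, hi1, hi2, hj1, hj2, hij, rfl⟩
    · right; left; exact ⟨a, j, hi1, hi2, hj1, hj2, hij, by simp⟩
    · right; left; exact ⟨i, b, hi1, hi2, hj1, hj2, hij, by simp [hc2]⟩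
    · left; exact ⟨i, j, hi1, hi2, hj1, hj2, hij, by simp [hc]⟩

theorem genB_rf {n g} (h : g ∈ genB n) :
    ∃ a b, a ∈ signedSet n ∧ b ∈ signedSet n ∧ a ≠ b ∧ g = rf a b := by
  have key : ∀ i : ℤ, 1 ≤ i → i ≤ n → i ∈ signedSet n := fun i h1 h2 =>
    ⟨by omega, by rw [abs_of_pos (by omega)]; exact h2⟩
  rcases h with ⟨i, j, h1, h2, h3, h4, h5, rfl⟩ | ⟨i, j, h1, h2, h3, h4, h5, rfl⟩ | ⟨i, h1, h2, rfl⟩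
  · exact ⟨i, j, key i h1 h2, key j h3 h4, h5, by rw [rf, if_neg (by omega)]⟩
  · exact ⟨i, -j, key i h1 h2, ss_neg.2 (key j h3 h4), by omega, by
      rw [rf, if_neg (by omega)]; simp⟩
  · exact ⟨i, -i, key i h1 h2, ss_neg.2 (key i h1 h2), by omega, by rw [rf, if_pos rfl]⟩

theorem rf_fix {n a b} (v : ℤ → ℚ) (hv : v ∈ Vn n) (h : v a = v b) : v ∈ FV n (rf a b) := by
  refine ⟨hv, fun x => ?_⟩
  have h2 : v (-a) = v (-b) := by rw [hv.1, hv.1, h]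
  unfold rf; split_ifs with h1
  · simp only [Equiv.swap_apply_def]; split_ifs <;> simp_all
  · simp only [Equiv.Perm.mul_apply, Equiv.swap_apply_def]; split_ifs <;> simp_all

theorem dV_rf {n a b} : DV n ≤ dV n (rf a b) + 1 := by
  let f : Vn n →ₗ[ℚ] ℚ :=
    { toFun := fun v => v.1 a - v.1 b
      map_add' := fun x y => by simp; ring
      map_smul' := fun c x => by simp; ring }
  have h := f.finrank_range_add_finrank_ker
  have h1 : finrank ℚ (LinearMap.range f) ≤ 1 := by
    simpa using Submodule.finrank_le (LinearMap.range f)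
  have h2 : finrank ℚ (LinearMap.ker f) ≤ dV n (rf a b) := by
    have : finrank ℚ ((LinearMap.ker f).map (Vn n).subtype) = finrank ℚ (LinearMap.ker f) :=
      (LinearEquiv.finrank_eq (Submodule.equivMapOfInjective _ (Vn n).injective_subtype _)).symm
    rw [← this]
    apply Submodule.finrank_mono
    rintro _ ⟨v, hv, rfl⟩
    refine rf_fix _ v.2 ?_
    have : v.1 a - v.1 b = 0 := hv
    simpa [sub_eq_zero] using this
  unfold DV
  omega

theorem dV_lt {n a b} (hle : FV n a ≤ FV n b) (v) (h1 : v ∈ FV n b) (h2 : v ∉ FV n a) :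
    dV n a + 1 ≤ dV n b :=
  Submodule.finrank_lt_finrank_of_lt (lt_of_le_of_ne hle (fun h => h2 (h ▸ h1)))

theorem ne_mem {n w x} (hw : inB n w) (h : w x ≠ x) : x ∈ signedSet n := by
  by_contra h2; exact h (hw.2 x h2)

theorem peel {n w x z} (hw : inB n w) (h : w z = x) (hne : z ≠ x) :
    dV n w + 1 ≤ dV n (w * rf x z) := by
  have hz : z ∈ signedSet n := ne_mem hw (by rw [h]; exact hne.symm)
  have hx : x ∈ signedSet n := h ▸ inB_mem hw hz
  have hx0 := hx.1
  have hfx : (w * rf x z) x = x := by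
    rw [Equiv.Perm.mul_apply, rf_left _ _ hx0, h]
  have hB : inB n (w * rf x z) := inB_mul hw (inB_rf hx hz)
  refine dV_lt ?_ (fun y => if y = x then 1 else if y = -x then -1 else 0) ?_ ?_
  · rintro v ⟨h1, h2⟩
    refine FV_inf_le n w (rf x z) ⟨⟨h1, h2⟩, rf_fix v h1 ?_⟩
    rw [← h, h2]
  · refine ⟨⟨fun y => ?_, fun y hy => ?_⟩, fun y => ?_⟩
    · beta_reduce; split_ifs <;> first | omega | norm_num
    · beta_reduce; rw [if_neg (by rintro rfl; exact hy hx), if_neg (by rintro rfl; exact hy (ss_neg.2 hx))]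
    · have e1 : (w * rf x z) y = x ↔ y = x := by
        constructor
        · intro hh; exact (w * rf x z).injective (hh.trans hfx.symm)
        · rintro rfl; exact hfx
      have e2 : (w * rf x z) y = -x ↔ y = -x := by
        have hfx' : (w * rf x z) (-x) = -x := by rw [hB.1, hfx]
        constructor
        · intro hh; exact (w * rf x z).injective (hh.trans hfx'.symm)
        · rintro rfl; exact hfx'
      simp only [e1, e2]
  · rintro ⟨-, h2⟩
    have := h2 z
    rw [h] at this
    simp only [if_true, if_neg hne] at this
    split_ifs at this <;> norm_num at this

theorem dV_eq_one {n w} (hw : inB n w) (h : dV n w = DV n) : w = 1 := by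
  by_contra hne
  have : ∃ z, w z ≠ z := by
    by_contra hh; push Not at hh; exact hne (Equiv.ext hh)
  obtain ⟨z, hz⟩ := this
  have h1 := peel hw rfl hz.symm
  have := dV_le n (w * rf (w z) z)
  omega

theorem prod_dV {n} (l : List (Equiv.Perm ℤ)) (h : ∀ g ∈ l, g ∈ genB n) :
    DV n ≤ l.length + dV n l.prod := by
  induction l with
  | nil => simp [dV_one]
  | cons g l ih =>
    have h1 := ih (fun g hg => h g (by simp [hg]))
    obtain ⟨a, b, -, -, -, rfl⟩ := genB_rf (h g (by simp))
    have h2 := dV_mul n (rf a b) l.prod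
    have h3 := dV_rf (n := n) (a := a) (b := b)
    simp only [List.length_cons, List.prod_cons]
    omega

theorem exists_word {n} (k : ℕ) : ∀ w, inB n w → dV n w + k = DV n →
    ∃ l : List (Equiv.Perm ℤ), l.length ≤ k ∧ (∀ g ∈ l, g ∈ genB n) ∧ l.prod = w := by
  induction k with
  | zero => intro w hw h; exact ⟨[], by simp, by simp, (dV_eq_one hw (by omega)).symm⟩
  | succ k ih =>
    intro w hw h
    by_cases hw1 : w = 1
    · rw [hw1, dV_one] at h; omega
    have : ∃ z, w z ≠ z := by
      by_contra hh; push Not at hh; exact hw1 (Equiv.ext hh)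
    obtain ⟨z, hz⟩ := this
    have hzm := ne_mem hw hz
    have hxm := inB_mem hw hzm
    have h1 := peel hw rfl hz.symm
    have h2 := dV_le n (w * rf (w z) z)
    have h3 := dV_mul n w (rf (w z) z)
    have h4 := dV_rf (n := n) (a := w z) (b := z)
    have h5 := dV_mul n (w * rf (w z) z) (rf (w z) z)
    rw [mul_assoc, rf_invol _ _ hxm.1 hzm.1, mul_one] at h5
    obtain ⟨l, hl1, hl2, hl3⟩ := ih (w * rf (w z) z) (inB_mul hw (inB_rf hxm hzm)) (by omega)
    refine ⟨l ++ [rf (w z) z], by simp; omega, ?_, ?_⟩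
    · intro g hg
      simp only [List.mem_append, List.mem_singleton] at hg
      rcases hg with hg | rfl
      · exact hl2 g hg
      · exact rf_mem_genB hxm hzm hz
    · simp [hl3, mul_assoc, rf_invol _ _ hxm.1 hzm.1]

theorem lenB_eq {n w} (hw : inB n w) : lenB n w + dV n w = DV n := by
  have hle := dV_le n w
  obtain ⟨l, h1, h2, h3⟩ := exists_word (DV n - dV n w) w hw (by omega)
  have hne : {k : ℕ | ∃ l : List (Equiv.Perm ℤ),
    l.length = k ∧ (∀ g ∈ l, g ∈ genB n) ∧ l.prod = w}.Nonempty := ⟨_, l, rfl, h2, h3⟩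
  obtain ⟨l', h1', h2', h3'⟩ := Nat.sInf_mem hne
  have h4 : lenB n w ≤ l.length := Nat.sInf_le ⟨l, rfl, h2, h3⟩
  have h5 := prod_dV l' h2'
  rw [h3', h1'] at h5
  change DV n ≤ lenB n w + _ at h5
  omega

/-- order in terms of fixed spaces -/
def leD (n : ℕ) (τ w : Equiv.Perm ℤ) : Prop := dV n τ + dV n (τ⁻¹ * w) = DV n + dV n w

theorem leB_iff {n τ w} (h1 : inB n τ) (h2 : inB n w) : leB n τ w ↔ leD n τ w := by
  have a := lenB_eq h1
  have b := lenB_eq h2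
  have c := lenB_eq (inB_mul (inB_inv h1) h2)
  unfold leB leD
  omega

theorem leD_refl {n τ} : leD n τ τ := by
  simp [leD, dV_one, add_comm]

theorem leD_iff {n τ w} : leD n τ w ↔ DV n + dV n w ≤ dV n τ + dV n (τ⁻¹ * w) := by
  have := dV_mul n τ (τ⁻¹ * w)
  rw [mul_inv_cancel_left] at this
  unfold leD
  omega

theorem leD_peel {n τ w x z} (h1 : inB n τ) (h2 : inB n w) (h : leD n τ w)
    (hz : w z = τ x) (hne : z ≠ x) : leD n τ (w * rf x z) ∧ inB n (w * rf x z) := by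
  have hB := inB_mul (inB_inv h1) h2
  have hk : (τ⁻¹ * w) z = x := by
    rw [Equiv.Perm.mul_apply, hz]; simp
  have hzm := ne_mem hB (by rw [hk]; exact hne.symm)
  have hxm : x ∈ signedSet n := hk ▸ inB_mem hB hzm
  have hp := peel hB hk hne
  refine ⟨?_, inB_mul h2 (inB_rf hxm hzm)⟩
  rw [leD_iff]
  rw [mul_assoc] at hp
  have h5 := dV_mul n (w * rf x z) (rf x z)
  rw [mul_assoc, rf_invol _ _ hxm.1 hzm.1, mul_one] at h5
  have h4 := dV_rf (n := n) (a := x) (b := z)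
  unfold leD at h
  omega

theorem leD_up {n τ w x z} (hx : x ≠ 0) (hz : z ≠ 0) (h : leD n τ (w * rf x z))
    (hd : dV n w + 1 ≤ dV n (w * rf x z)) : leD n τ w := by
  rw [leD_iff]
  unfold leD at h
  have h5 := dV_mul n (τ⁻¹ * (w * rf x z)) (rf x z)
  rw [mul_assoc, mul_assoc, rf_invol _ _ hx hz, mul_one] at h5
  have h4 := dV_rf (n := n) (a := x) (b := z)
  omega

theorem leD_fix {n τ w} (h : leD n τ w) : FV n w ≤ FV n τ := by
  have h1 := dV_inf n τ (τ⁻¹ * w)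
  have h2 := FV_inf_le n τ (τ⁻¹ * w)
  rw [mul_inv_cancel_left] at h2
  unfold leD at h
  have h3 : FV n τ ⊓ FV n (τ⁻¹ * w) = FV n w := by
    apply Submodule.eq_of_le_of_finrank_le h2
    change dV n w ≤ _
    omega
  rw [← h3]; exact inf_le_left

open Module

def Ch (τ : Equiv.Perm ℤ) (l : List ℤ) : Prop := l.IsChain (fun a c => τ a = c)

def Cyc (τ : Equiv.Perm ℤ) (l : List ℤ) : Prop :=
  Ch τ l ∧ ∀ x ∈ l.getLast?, ∀ y ∈ l.head?, τ x = y

def SN (n : ℕ) (l : List ℤ) : Prop := l.Nodup ∧ (∀ x ∈ l, x ∈ signedSet n) ∧ ∀ x ∈ l, -x ∉ l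

theorem SN.perm {n l l'} (h : SN n l) (hp : l.Perm l') : SN n l' :=
  ⟨hp.nodup_iff.1 h.1, fun x hx => h.2.1 x (hp.mem_iff.2 hx), fun x hx hx' =>
    h.2.2 x (hp.mem_iff.2 hx) (hp.mem_iff.2 hx')⟩

theorem SN.sub {n l l'} (h : SN n l) (hp : l'.Sublist l) : SN n l' :=
  ⟨h.1.sublist hp, fun x hx => h.2.1 x (hp.subset hx), fun x hx hx' =>
    h.2.2 x (hp.subset hx) (hp.subset hx')⟩

theorem Cyc_app {τ m k} (hm : m ≠ []) (hk : k ≠ []) : Cyc τ (m ++ k) ↔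
    Ch τ m ∧ Ch τ k ∧ (∀ x ∈ m.getLast?, ∀ y ∈ k.head?, τ x = y) ∧
      (∀ x ∈ k.getLast?, ∀ y ∈ m.head?, τ x = y) := by
  unfold Cyc Ch
  rw [List.isChain_append, List.getLast?_append_of_ne_nil _ hk, List.head?_append_of_ne_nil _ hm]
  tauto

theorem Cyc_rot {τ m k} (h : Cyc τ (m ++ k)) : Cyc τ (k ++ m) := by
  by_cases hm : m = []
  · subst hm; simpa using h
  by_cases hk : k = []
  · subst hk; simpa using h
  rw [Cyc_app hm hk] at h
  rw [Cyc_app hk hm]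
  tauto

theorem Ch_congr {w w' : Equiv.Perm ℤ} {m x} (h : Ch w (m ++ [x])) (he : ∀ a ∈ m, w' a = w a) :
    Ch w' (m ++ [x]) := by
  induction m with
  | nil => simp [Ch]
  | cons a m ih =>
    have hi := fun h' => ih h' (fun a ha => he a (by simp [ha]))
    have ha := he a (by simp)
    cases m with
    | nil => simp only [Ch, List.cons_append, List.nil_append, List.isChain_cons_cons] at *; simp_all
    | cons b m =>
      simp only [Ch, List.cons_append, List.isChain_cons_cons] at *
      exact ⟨ha.trans h.1, hi h.2⟩

theorem Cyc_congr {w w' : Equiv.Perm ℤ} {m} (h : Cyc w m) (he : ∀ a ∈ m, w' a = w a) :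
    Cyc w' m := by
  rcases List.eq_nil_or_concat' m with rfl | ⟨m, x, rfl⟩
  · simp [Cyc, Ch]
  · refine ⟨Ch_congr h.1 (fun a ha => he a (by simp [ha])), fun y hy z hz => ?_⟩
    simp only [List.getLast?_append, List.getLast?_singleton, Option.some_or, Option.mem_def,
      Option.some.injEq] at hy
    subst hy
    rw [he _ (by simp)]
    exact h.2 _ (by simp) z hz

theorem Cyc_split_aux {n w m x k z} (hs : SN n (m ++ [x] ++ (k ++ [z])))
    (h : Cyc w (m ++ [x] ++ (k ++ [z]))) : Cyc (w * rf x z) (m ++ [x]) := by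
  have hx0 : x ≠ 0 := (hs.2.1 x (by simp)).1
  rw [Cyc_app (by simp) (by simp)] at h
  obtain ⟨h1, h2, h3, h4⟩ := h
  refine ⟨Ch_congr h1 (fun a ha => ?_), fun y hy u hu => ?_⟩
  · rw [Equiv.Perm.mul_apply, rf_ne]
    · rintro rfl
      have := (hs.sub (List.sublist_append_left _ _)).1
      rw [List.nodup_append] at this
      exact this.2.2 a ha a (by simp) rfl
    · rintro rfl
      have := hs.1
      rw [List.nodup_append] at this
      exact this.2.2 a (by simp [ha]) a (by simp) rfl
    · intro e
      have : x = -a := by omega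
      exact hs.2.2 a (by simp [ha]) (this ▸ by simp)
    · intro e
      have : z = -a := by omega
      exact hs.2.2 a (by simp [ha]) (this ▸ by simp)
  · have : y = x := by simpa using hy.symm
    subst this
    rw [Equiv.Perm.mul_apply, rf_left _ _ hx0]
    exact h4 z (by simp) u hu

theorem rf_comm (x z : ℤ) : rf x z = rf z x := by
  unfold rf
  split_ifs with h1 h2 h2
  · rw [Equiv.swap_comm]
  · omega
  · omega
  · rw [Equiv.swap_comm, Equiv.swap_comm (-x)]

theorem Cyc_split {n w m x k z} (hs : SN n (m ++ [x] ++ (k ++ [z])))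
    (h : Cyc w (m ++ [x] ++ (k ++ [z]))) :
    Cyc (w * rf x z) (m ++ [x]) ∧ Cyc (w * rf x z) (k ++ [z]) := by
  refine ⟨Cyc_split_aux hs h, ?_⟩
  rw [rf_comm]
  exact Cyc_split_aux (hs.perm List.perm_append_comm) (Cyc_rot h)

theorem Ch_next {τ u x y v} (h : Ch τ (u ++ x :: y :: v)) : τ x = y := by
  unfold Ch at h
  rw [List.isChain_append] at h
  exact (List.isChain_cons_cons.1 h.2.1).1

theorem Cyc_last {τ x l y} (h : Cyc τ (x :: l ++ [y])) : τ y = x := h.2 y (List.getLast?_concat) x (by simp)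

theorem Cyc_last' {τ x l y} (h : Cyc τ l) (h1 : l.getLast? = some y) (h2 : l.head? = some x) :
    τ y = x := h.2 y h1 x h2

theorem Cyc_mem {τ l x} (h : Cyc τ l) (hx : x ∈ l) : τ x ∈ l := by
  obtain ⟨u, v, rfl⟩ := List.append_of_mem hx
  have h' := Cyc_rot h
  cases v with
  | nil =>
    cases u with
    | nil => rw [Cyc_last' h (y := x) (x := x) rfl rfl]; simp
    | cons a u => rw [Cyc_last h]; simp
  | cons y v =>
    rw [Ch_next h.1]; simp

theorem Cyc_pred {τ l x} (h : Cyc τ l) (hx : x ∈ l) : ∃ y ∈ l, τ y = x := by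
  obtain ⟨u, v, rfl⟩ := List.append_of_mem hx
  have h' := Cyc_rot h
  rcases List.eq_nil_or_concat' (v ++ u) with h0 | ⟨k, z, hk⟩
  · simp only [List.append_eq_nil_iff] at h0
    obtain ⟨rfl, rfl⟩ := h0
    exact ⟨x, by simp, Cyc_last' h rfl rfl⟩
  · rw [List.cons_append, hk] at h'
    refine ⟨z, ?_, Cyc_last (x := x) (l := k) h'⟩
    have : z ∈ v ++ u := by rw [hk]; simp
    simp only [List.mem_append, List.mem_cons] at *; tauto

theorem Cyc_mem_iff {τ l x} (h : Cyc τ l) : τ x ∈ l ↔ x ∈ l := by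
  refine ⟨fun hx => ?_, Cyc_mem h⟩
  obtain ⟨y, hy, e⟩ := Cyc_pred h hx
  rwa [← τ.injective e]

theorem Ch_const {τ : Equiv.Perm ℤ} {l : List ℤ} {x : ℤ} (h : Ch τ (x :: l)) :
    ∀ y ∈ l, τ.SameCycle x y := by
  induction l generalizing x with
  | nil => simp
  | cons a l ih =>
    unfold Ch at *
    rw [List.isChain_cons_cons] at h
    have hxa : τ.SameCycle x a := ⟨1, by simpa using h.1⟩
    intro y hy
    rcases List.mem_cons.1 hy with rfl | hy
    · exact hxa
    · exact hxa.trans (ih h.2 y hy)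

theorem Cyc_same {τ : Equiv.Perm ℤ} {l : List ℤ} {x y : ℤ} (h : Cyc τ l) (hx : x ∈ l) (hy : y ∈ l) :
    τ.SameCycle x y := by
  cases l with
  | nil => simp at hx
  | cons a l =>
    have key : ∀ z ∈ a :: l, τ.SameCycle a z := by
      intro z hz
      rcases List.mem_cons.1 hz with rfl | hz
      · exact Equiv.Perm.SameCycle.refl _ _
      · exact Ch_const h.1 z hz
    exact (key x hx).symm.trans (key y hy)

theorem Cyc_zpow {τ : Equiv.Perm ℤ} {l : List ℤ} (h : Cyc τ l) (m : ℤ) :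
    ∀ x ∈ l, (τ ^ m) x ∈ l := by
  induction m using Int.induction_on with
  | zero => simp
  | succ i ih => intro x hx; rw [zpow_add_one, Equiv.Perm.mul_apply]; exact ih _ (Cyc_mem h hx)
  | pred i ih =>
    intro x hx; rw [zpow_sub_one, Equiv.Perm.mul_apply]
    refine ih _ ?_
    rw [← Cyc_mem_iff h]; simpa using hx

theorem Cyc_orbit {τ : Equiv.Perm ℤ} {l : List ℤ} {x : ℤ} (h : Cyc τ l) (hx : x ∈ l) :
    permOrbit τ x = {y | y ∈ l} := by
  ext y
  constructor
  · rintro ⟨m, rfl⟩; exact Cyc_zpow h m x hx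
  · intro hy; exact Cyc_same h hx hy

theorem FV_same {n τ v} (hv : v ∈ FV n τ) {x y} (h : τ.SameCycle x y) : v x = v y := by
  obtain ⟨m, rfl⟩ := h
  induction m using Int.induction_on generalizing x with
  | zero => simp
  | succ i ih => rw [zpow_add_one, Equiv.Perm.mul_apply, ← ih, hv.2]
  | pred i ih =>
    rw [zpow_sub_one, Equiv.Perm.mul_apply, ← ih]
    conv_lhs => rw [show x = τ (τ⁻¹ x) by simp]
    rw [hv.2]

open Classical in
noncomputable def ind (b : List ℤ) : ℤ → ℚ := fun x => if x ∈ b then 1 else if -x ∈ b then -1 else 0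

theorem ind_mem {n w b} (hw : inB n w) (h : Cyc w b) (hs : SN n b) : ind b ∈ FV n w := by
  refine ⟨⟨fun x => ?_, fun x hx => ?_⟩, fun x => ?_⟩
  · unfold ind
    have := hs.2.2 x
    simp only [neg_neg]
    split_ifs <;> simp_all
  · unfold ind
    rw [if_neg (fun h' => hx (hs.2.1 x h')), if_neg (fun h' => hx (ss_neg.1 (hs.2.1 _ h')))]
  · unfold ind
    have h2 : -(w x) ∈ b ↔ -x ∈ b := by rw [← hw.1, Cyc_mem_iff h]
    simp only [Cyc_mem_iff h, h2]

theorem leD_mem {n τ w b} (hw : inB n w) (h : Cyc w b) (hs : SN n b) (hl : leD n τ w) {x}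
    (hx : x ∈ b) : τ x ∈ b := by
  have := (leD_fix hl (ind_mem hw h hs)).2 x
  by_contra hc
  unfold ind at this
  rw [if_pos hx, if_neg hc] at this
  split_ifs at this <;> norm_num at this

theorem dV_split {n w m x k z} (hw : inB n w) (hs : SN n (m ++ [x] ++ (k ++ [z])))
    (h : Cyc w (m ++ [x] ++ (k ++ [z]))) : dV n w + 1 ≤ dV n (w * rf x z) := by
  have hx := hs.2.1 x (by simp)
  have hz := hs.2.1 z (by simp)
  refine dV_lt ?_ (ind (m ++ [x])) (ind_mem (inB_mul hw (inB_rf hx hz)) (Cyc_split hs h).1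
    (hs.sub (by simp))) ?_
  · intro v hv
    exact FV_inf_le n _ _ ⟨hv, rf_fix v hv.1 (FV_same hv (Cyc_same h (by simp) (by simp)))⟩
  · intro hv
    have := FV_same hv (Cyc_same h (x := x) (y := z) (by simp) (by simp))
    have h1 : z ∉ m ++ [x] := by
      intro hz
      have := hs.1
      rw [List.nodup_append] at this
      exact this.2.2 z hz z (by simp) rfl
    unfold ind at this
    rw [if_pos (by simp), if_neg h1] at this
    split_ifs at this <;> norm_num at this

inductive PRun : List (List ℤ) → List (ℤ × Bool × Bool) → List (List ℤ) → List (List ℤ) → Prop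
  | nil (S) : PRun S [] S []
  | o {S w S' Ls x} : PRun ([x] :: S) w S' Ls → PRun S ((x, true, false) :: w) S' Ls
  | m {S w S' Ls x b} : PRun ((b ++ [x]) :: S) w S' Ls → PRun (b :: S) ((x, false, false) :: w) S' Ls
  | c {S w S' Ls x b} : PRun S w S' Ls → PRun (b :: S) ((x, false, true) :: w) S' ((b ++ [x]) :: Ls)
  | s {S w S' Ls x} : PRun S w S' Ls → PRun S ((x, true, true) :: w) S' ([x] :: Ls)

theorem PRun.comp {S w S' L w' S'' L'} (h : PRun S w S' L) (h' : PRun S' w' S'' L') :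
    PRun S (w ++ w') S'' (L ++ L') := by
  induction h with
  | nil S => exact h'
  | o _ ih => exact .o (ih h')
  | m _ ih => exact .m (ih h')
  | c _ ih => exact .c (ih h')
  | s _ ih => exact .s (ih h')

theorem PRun.decomp {w w' : List (ℤ × Bool × Bool)} : ∀ {S S'' L}, PRun S (w ++ w') S'' L →
    ∃ S' L1 L2, PRun S w S' L1 ∧ PRun S' w' S'' L2 ∧ L = L1 ++ L2 := by
  induction w with
  | nil => intro S S'' L h; exact ⟨S, [], L, .nil S, h, rfl⟩
  | cons a w ih =>
    intro S S'' L h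
    rw [List.cons_append] at h
    cases h with
    | o h => obtain ⟨S', L1, L2, h1, h2, rfl⟩ := ih h; exact ⟨S', L1, L2, .o h1, h2, rfl⟩
    | m h => obtain ⟨S', L1, L2, h1, h2, rfl⟩ := ih h; exact ⟨S', L1, L2, .m h1, h2, rfl⟩
    | c h => obtain ⟨S', L1, L2, h1, h2, rfl⟩ := ih h; exact ⟨S', _, L2, .c h1, h2, rfl⟩
    | s h => obtain ⟨S', L1, L2, h1, h2, rfl⟩ := ih h; exact ⟨S', _, L2, .s h1, h2, rfl⟩

theorem Ch_pred {τ : Equiv.Perm ℤ} {l : List ℤ} {a y : ℤ} (h : Ch τ (a :: l)) (hy : y ∈ l) :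
    ∃ x ∈ (a :: l).dropLast, τ x = y := by
  obtain ⟨u, v, rfl⟩ := List.append_of_mem hy
  have : ∃ u' x, a :: u = u' ++ [x] := by
    rcases List.eq_nil_or_concat' (a :: u) with h | h
    · simp at h
    · exact h
  obtain ⟨u', x, hu⟩ := this
  have e : a :: (u ++ y :: v) = u' ++ x :: y :: v := by
    rw [← List.cons_append, hu]; simp
  rw [e] at h ⊢
  refine ⟨x, ?_, Ch_next h⟩
  rw [List.dropLast_append_of_ne_nil (by simp)]
  simp

theorem close_cyc {τ : Equiv.Perm ℤ} {b : List ℤ} {z : ℤ} (h : Ch τ (b ++ [z]))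
    (hn : (b ++ [z]).Nodup) (hm : τ z ∈ b ++ [z]) : Cyc τ (b ++ [z]) := by
  refine ⟨h, fun x hx y hy => ?_⟩
  have : x = z := by simpa using hx.symm
  subst this
  cases hb : b ++ [x] with
  | nil => simp at hb
  | cons a l =>
    rw [hb] at hm hy h
    have : y = a := by simpa using hy.symm
    subst this
    rcases List.mem_cons.1 hm with h1 | h1
    · exact h1
    · exfalso
      obtain ⟨t, ht, e⟩ := Ch_pred h h1
      have e := τ.injective e
      subst e
      rw [← hb, List.dropLast_concat] at ht
      rw [List.nodup_append] at hn
      exact hn.2.2 t ht t (by simp) rfl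

theorem extract {n τ} (hτ : inB n τ) (N : ℕ) : ∀ (b r : List ℤ) (z : ℤ) (w : Equiv.Perm ℤ),
    r.length ≤ N → inB n w → leD n τ w → Cyc w (b ++ [z] ++ r) → SN n (b ++ [z] ++ r) →
    Ch τ (b ++ [z]) → ∃ (a : Bool) (wr : List (ℤ × Bool × Bool)) (Ls : List (List ℤ)),
      wr.map Prod.fst = r ∧ (∀ c ∈ Ls, Cyc τ c) ∧
      (b = [] → ∀ S, PRun S ((z, true, a) :: wr) S Ls) ∧
      (b ≠ [] → ∀ S, PRun (b :: S) ((z, false, a) :: wr) S Ls) := by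
  induction N with
  | zero =>
    intro b r z w hr hw hle hc hs hch
    have : r = [] := by simpa using hr
    subst this
    rw [List.append_nil] at hc hs
    have hcyc : Cyc τ (b ++ [z]) :=
      close_cyc hch hs.1 (leD_mem hw hc hs hle (x := z) (by simp))
    exact ⟨true, [], [b ++ [z]], rfl, by simpa using hcyc, by
      rintro rfl S; exact .s (.nil S), fun _ S => .c (.nil S)⟩
  | succ N ih =>
    intro b r z w hr hw hle hc hs hch
    have hm := leD_mem hw hc hs hle (x := z) (by simp)
    rw [List.mem_append] at hm
    have hnd : (b ++ [z]).Nodup := (hs.sub (List.sublist_append_left _ _)).1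
    rcases hm with hm | hm
    · have hcyc : Cyc τ (b ++ [z]) := close_cyc hch hnd hm
      rcases List.eq_nil_or_concat' r with rfl | ⟨r', z', rfl⟩
      · exact ⟨true, [], [b ++ [z]], rfl, by simpa using hcyc, by
          rintro rfl S; exact .s (.nil S), fun _ S => .c (.nil S)⟩
      · have hne : z' ≠ z := by
          rintro rfl
          have := hs.1
          simp [List.nodup_append] at this
        have hwz : w z' = τ z := by
          have h1 : ∃ y, (b ++ [z]).head? = some y := by cases b <;> simp
          obtain ⟨y, hy⟩ := h1
          rw [Cyc_last' hcyc List.getLast?_concat hy, Cyc_last' hc (y := z') (x := y)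
            (by rw [← List.append_assoc]; exact List.getLast?_concat)]
          rw [List.head?_append_of_ne_nil _ (by simp), hy]
        obtain ⟨hle', hw'⟩ := leD_peel hτ hw hle hwz hne
        have hc' := (Cyc_split hs hc).2
        have hs' : SN n (r' ++ [z']) := hs.sub (List.sublist_append_right _ _)
        have : ∃ z2 r2, r' ++ [z'] = z2 :: r2 := by cases r' <;> simp
        obtain ⟨z2, r2, e⟩ := this
        rw [e] at hc' hs' hr ⊢
        obtain ⟨a, wr, Ls, h1, h2, h3, -⟩ := ih [] r2 z2 _ (by simpa using hr) hw' hle' (by simpa using hc')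
          (by simpa using hs') (by simp [Ch])
        refine ⟨true, (z2, true, a) :: wr, (b ++ [z]) :: Ls, by simp [h1], ?_, ?_, ?_⟩
        · intro c hc
          rcases List.mem_cons.1 hc with rfl | hc
          · exact hcyc
          · exact h2 c hc
        · rintro rfl S; exact .s (h3 rfl S)
        · intro _ S; exact .c (h3 rfl S)
    · obtain ⟨u, v, hr'⟩ := List.append_of_mem hm
      have hch' : Ch τ (b ++ [z] ++ [τ z]) := by
        unfold Ch at *
        rw [List.isChain_append]
        exact ⟨hch, by simp, by simp⟩
      rcases List.eq_nil_or_concat' u with rfl | ⟨u, z', rfl⟩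
      · rw [List.nil_append] at hr'
        rw [hr'] at hr hc hs
        obtain ⟨a, wr, Ls, h1, h2, -, h3⟩ := ih (b ++ [z]) v (τ z) w (by simpa using hr) hw hle
          (by simpa using hc) (by simpa using hs) hch'
        refine ⟨false, (τ z, false, a) :: wr, Ls, by simp [h1, hr'], h2, ?_, ?_⟩
        · rintro rfl S; exact .o (h3 (by simp) S)
        · intro _ S; exact .m (h3 (by simp) S)
      · have e : b ++ [z] ++ r = b ++ [z] ++ (u ++ [z']) ++ τ z :: v := by rw [hr']; simp
        have hne : z' ≠ z := by
          rintro rfl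
          have := hs.1
          rw [e] at this
          simp [List.nodup_append] at this
        have hwz : w z' = τ z := by
          rw [e] at hc
          exact Ch_next (u := b ++ [z] ++ u) (v := v) (by simpa using hc.1)
        obtain ⟨hle', hw'⟩ := leD_peel hτ hw hle hwz hne
        rw [e] at hs hc
        have e2 : τ z :: v ++ b ++ [z] ++ (u ++ [z']) = τ z :: v ++ (b ++ [z] ++ (u ++ [z'])) := by simp
        have hc2 := Cyc_rot hc
        have hs2 := hs.perm (List.perm_append_comm)
        rw [← e2] at hc2 hs2
        obtain ⟨hA, hB⟩ := Cyc_split hs2 hc2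
        have hA' := Cyc_rot (m := τ z :: v) (k := b ++ [z]) (by simpa using hA)
        have hsA : SN n (b ++ [z] ++ [τ z] ++ v) := hs.sub (by simp)
        have hsB : SN n (u ++ [z']) := hs.sub (by
          rw [List.append_assoc]
          exact (List.sublist_append_left _ _).trans (List.sublist_append_right _ _))
        have hlen : u.length + 1 + (v.length + 1) ≤ N + 1 := by
          rw [hr'] at hr; simp at hr; omega
        obtain ⟨a, wr, Ls, h1, h2, -, h3⟩ := ih (b ++ [z]) v (τ z) _ (by omega) hw' hle'
          (by simpa using hA') hsA hch'
        have : ∃ z2 r2, u ++ [z'] = z2 :: r2 := by cases u <;> simp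
        obtain ⟨z2, r2, e3⟩ := this
        have hl3 := congrArg List.length e3
        simp only [List.length_append, List.length_cons, List.length_nil] at hl3
        rw [e3] at hB hsB
        obtain ⟨a', wr', Ls', h1', h2', h3', -⟩ := ih [] r2 z2 _ (by omega) hw' hle'
          (by simpa using hB) (by simpa using hsB) (by simp [Ch])
        refine ⟨false, ((z2, true, a') :: wr') ++ (τ z, false, a) :: wr, Ls' ++ Ls, ?_, ?_, ?_, ?_⟩
        · rw [hr', e3]; simp [h1, h1']
        · intro c hc
          rcases List.mem_append.1 hc with hc | hc
          · exact h2' c hc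
          · exact h2 c hc
        · rintro rfl S; exact .o ((h3' rfl _).comp (h3 (by simp) S))
        · intro _ S; exact .m ((h3' rfl _).comp (h3 (by simp) S))

theorem extract_all {n τ w l} (hτ : inB n τ) (hw : inB n w) (hle : leD n τ w) (hc : Cyc w l)
    (hs : SN n l) : ∃ wr Ls, wr.map Prod.fst = l ∧ (∀ c ∈ Ls, Cyc τ c) ∧ PRun [] wr [] Ls := by
  cases l with
  | nil => exact ⟨[], [], rfl, by simp, .nil _⟩
  | cons z r =>
    obtain ⟨a, wr, Ls, h1, h2, h3, -⟩ := extract hτ r.length [] r z w le_rfl hw hle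
      (by simpa using hc) (by simpa using hs) (by simp [Ch])
    exact ⟨_, Ls, by simp [h1], h2, h3 rfl _⟩

theorem build {n S w S' Ls} (h : PRun S w S' Ls) : ∀ W, S' = [] → inB n W →
    Cyc W (S.reverse.flatten ++ w.map Prod.fst) → SN n (S.reverse.flatten ++ w.map Prod.fst) →
    ∃ τ, inB n τ ∧ leD n τ W ∧ (∀ b ∈ Ls, Cyc τ b) ∧
      ∀ x, x ∉ S.reverse.flatten ++ w.map Prod.fst → -x ∉ S.reverse.flatten ++ w.map Prod.fst →
        τ x = W x := by
  -- common closing step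
  have close : ∀ (S : List (List ℤ)) (w : List (ℤ × Bool × Bool)) (Ls) (b : List ℤ) (x : ℤ),
      PRun S w [] Ls →
      (∀ W, inB n W → Cyc W (S.reverse.flatten ++ w.map Prod.fst) →
        SN n (S.reverse.flatten ++ w.map Prod.fst) → ∃ τ, inB n τ ∧ leD n τ W ∧ (∀ b ∈ Ls, Cyc τ b) ∧
        ∀ x, x ∉ S.reverse.flatten ++ w.map Prod.fst → -x ∉ S.reverse.flatten ++ w.map Prod.fst →
        τ x = W x) → ∀ W, inB n W →
      Cyc W (S.reverse.flatten ++ (b ++ [x]) ++ w.map Prod.fst) →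
      SN n (S.reverse.flatten ++ (b ++ [x]) ++ w.map Prod.fst) →
      ∃ τ, inB n τ ∧ leD n τ W ∧ (∀ d ∈ (b ++ [x]) :: Ls, Cyc τ d) ∧
        ∀ y, y ∉ S.reverse.flatten ++ (b ++ [x]) ++ w.map Prod.fst →
          -y ∉ S.reverse.flatten ++ (b ++ [x]) ++ w.map Prod.fst → τ y = W y := by
    intro S w Ls b x hR ih W hW hc hs
    have hc2 : Cyc W ((b ++ [x]) ++ (w.map Prod.fst ++ S.reverse.flatten)) := by
      rw [List.append_assoc] at hc
      simpa using Cyc_rot hc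
    have hs2 : SN n ((b ++ [x]) ++ (w.map Prod.fst ++ S.reverse.flatten)) := by
      rw [List.append_assoc] at hs
      simpa using hs.perm List.perm_append_comm
    rcases List.eq_nil_or_concat' (w.map Prod.fst ++ S.reverse.flatten) with h0 | ⟨k, z, hk⟩
    · have h1 : w.map Prod.fst = [] ∧ S.reverse.flatten = [] := by simpa using h0
      obtain ⟨τ, a1, a2, a3, a4⟩ := ih W hW (by rw [h1.1, h1.2]; simp [Cyc, Ch])
        (by rw [h1.1, h1.2]; simp [SN])
      have : τ = W := Equiv.ext fun y => a4 y (by rw [h1.1, h1.2]; simp) (by rw [h1.1, h1.2]; simp)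
      subst this
      rw [h0, List.append_nil] at hc2
      refine ⟨τ, a1, a2, ?_, fun _ _ _ => rfl⟩
      intro c hc
      rcases List.mem_cons.1 hc with rfl | hc
      · exact hc2
      · exact a3 c hc
    · rw [hk] at hc2 hs2
      obtain ⟨hA, hB⟩ := Cyc_split hs2 hc2
      have hx := hs2.2.1 x (by simp)
      have hz := hs2.2.1 z (by simp)
      have hW' := inB_mul hW (inB_rf hx hz)
      have hmem : ∀ y, y ∈ S.reverse.flatten ++ w.map Prod.fst ↔ y ∈ k ++ [z] := by
        intro y; rw [← hk, List.mem_append, List.mem_append, or_comm]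
      have hmem2 : ∀ y, y ∈ S.reverse.flatten ++ (b ++ [x]) ++ w.map Prod.fst ↔
          y ∈ b ++ [x] ∨ y ∈ k ++ [z] := by
        intro y; rw [← hk]; simp only [List.mem_append]; tauto
      have hsk : SN n (k ++ [z]) := hs2.sub (List.sublist_append_right _ _)
      have hd : ∀ y ∈ b ++ [x], y ∉ k ++ [z] := by
        intro y hy hy2
        have := hs2.1
        rw [List.nodup_append] at this
        exact this.2.2 y hy y hy2 rfl
      obtain ⟨τ, a1, a2, a3, a4⟩ := ih (W * rf x z) hW'
        (by rw [← hk] at hB; exact Cyc_rot hB)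
        (by rw [← hk] at hsk; exact hsk.perm List.perm_append_comm)
      refine ⟨τ, a1, leD_up hx.1 hz.1 a2 (dV_split hW hs2 hc2), ?_, ?_⟩
      · intro c hc
        rcases List.mem_cons.1 hc with rfl | hc
        · refine Cyc_congr hA (fun a ha => a4 a ?_ ?_)
          · rw [hmem]; exact hd a ha
          · rw [hmem]; intro h
            exact hs2.2.2 a (List.mem_append_left _ ha) (List.mem_append_right _ h)
        · exact a3 c hc
      · intro y h1 h2
        rw [hmem2] at h1 h2
        push Not at h1 h2
        rw [a4 y (by rw [hmem]; exact h1.2) (by rw [hmem]; exact h2.2), Equiv.Perm.mul_apply, rf_ne]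
        · rintro rfl; exact h1.1 (by simp)
        · rintro rfl; exact h1.2 (by simp)
        · rintro rfl; exact h2.1 (by simp)
        · rintro rfl; exact h2.2 (by simp)
  induction h with
  | nil S =>
    rintro W rfl hW - -
    exact ⟨W, hW, leD_refl, by simp, fun _ _ _ => rfl⟩
  | o _ ih => intro W h1 h2 h3 h4; simpa using ih W h1 h2 (by simpa using h3) (by simpa using h4)
  | m _ ih => intro W h1 h2 h3 h4; simpa using ih W h1 h2 (by simpa using h3) (by simpa using h4)
  | @c S w S' Ls x b hR ih =>
    rintro W rfl h2 h3 h4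
    have := close S w Ls b x hR (fun W => ih W rfl) W h2 (by simpa using h3) (by simpa using h4)
    simpa using this
  | @s S w S' Ls x hR ih =>
    rintro W rfl h2 h3 h4
    have := close S w Ls [] x hR (fun W => ih W rfl) W h2 (by simpa using h3) (by simpa using h4)
    simpa using this


def VV : ℕ → List (Bool × Bool) → ℕ → Prop
  | h, [], k => h = k
  | h, (true, false) :: w, k => VV (h + 1) w k
  | h, (true, true) :: w, k => VV h w k
  | 0, (false, _) :: _, _ => False
  | h + 1, (false, false) :: w, k => VV (h + 1) w k
  | h + 1, (false, true) :: w, k => VV h w k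

def Bw : ℕ → ℕ → ℕ → Finset (List (Bool × Bool))
  | 0, c, i => if c = 0 ∧ i = 0 then {[]} else ∅
  | q + 1, c, i => ((match i with
      | 0 => ∅
      | i + 1 => (Bw q (c + 1) i).image (List.cons (true, false))) ∪
      (match i with
      | 0 => ∅
      | i + 1 => (Bw q c i).image (List.cons (true, true)))) ∪
      ((match c with
      | 0 => ∅
      | c + 1 => (Bw q (c + 1) i).image (List.cons (false, false))) ∪
      (match c with
      | 0 => ∅
      | c + 1 => (Bw q c i).image (List.cons (false, true))))

theorem mem_Bw (q : ℕ) : ∀ (c i : ℕ) (w : List (Bool × Bool)), w ∈ Bw q c i ↔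
    w.length = q ∧ VV c w 0 ∧ w.countP (fun a => a.1) = i := by
  induction q with
  | zero =>
    intro c i w
    rw [Bw]
    constructor
    · split_ifs with h
      · obtain ⟨rfl, rfl⟩ := h
        intro hw
        rw [Finset.mem_singleton] at hw
        subst hw; simp [VV]
      · simp
    · rintro ⟨h1, h2, h3⟩
      obtain rfl : w = [] := by simpa using h1
      simp [VV] at h2 h3
      simp [h2, ← h3]
  | succ q ih =>
    intro c i w
    rw [Bw.eq_def]
    cases w with
    | nil => cases c <;> cases i <;> simp
    | cons a w =>
      obtain ⟨o, cl⟩ := a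
      cases c <;> cases i <;> cases o <;> cases cl <;> simp [VV, ih]

theorem Bw_card_succ (q c i : ℕ) : (Bw (q + 1) c i).card = ((match i with
      | 0 => 0
      | i + 1 => (Bw q (c + 1) i).card) + (match i with
      | 0 => 0
      | i + 1 => (Bw q c i).card)) + ((match c with
      | 0 => 0
      | c + 1 => (Bw q (c + 1) i).card) + (match c with
      | 0 => 0
      | c + 1 => (Bw q c i).card)) := by
  rw [Bw.eq_def]
  have hi : ∀ a : Bool × Bool, Function.Injective (List.cons a) := fun a => List.cons_injective
  rw [Finset.card_union_of_disjoint, Finset.card_union_of_disjoint, Finset.card_union_of_disjoint]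
  · cases c <;> cases i <;> simp [Finset.card_image_of_injective, hi]
  · cases c <;> simp [Finset.disjoint_left]
  · cases i <;> simp [Finset.disjoint_left]
  · cases c <;> cases i <;> simp [Finset.disjoint_left] <;> aesop

theorem Bw_card (q : ℕ) : ∀ c i : ℕ, ((Bw (q + 1) c i).card : ℤ) =
    (q + 1).choose i * (q + 1).choose (i + c) - (q + 2).choose i * q.choose (i + c) := by
  induction q with
  | zero =>
    intro c i
    rw [Bw_card_succ]
    rcases c with _ | _ | c <;> rcases i with _ | _ | i <;>
      simp [Bw, Nat.choose_eq_zero_of_lt] 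
  | succ q ih =>
    intro c i
    rw [Bw_card_succ]
    have P : ∀ n k : ℕ, ((n + 1).choose (k + 1) : ℤ) = n.choose k + n.choose (k + 1) := by
      intro n k; exact_mod_cast Nat.choose_succ_succ n k
    rcases c with _ | c <;> rcases i with _ | i
    · simp
    · push_cast
      simp only [ih]
      have e : i + (0 + 1) = i + 1 := by ring
      simp only [add_zero, e]
      rw [P (q + 1) i, P (q + 2) i, P q i]
      rw [P (q + 1) i, P q i]
      ring
    · push_cast
      simp only [ih]
      simp only [zero_add]
      rw [P (q + 1) c, P q c]
      simp
    · push_cast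
      simp only [ih]
      have e1 : i + (c + 1 + 1) = i + c + 1 + 1 := by ring
      have e2 : i + (c + 1) = i + c + 1 := by ring
      have e3 : i + 1 + (c + 1) = i + c + 1 + 1 := by ring
      have e4 : i + 1 + c = i + c + 1 := by ring
      simp only [e1, e2, e3, e4]
      rw [P (q + 1) i, P (q + 2) i, P (q + 1) (i + c + 1), P q (i + c + 1)]
      rw [P (q + 1) i]
      ring

/-- words whose first letter does not open -/
def Hw (q c i : ℕ) : Finset (List (Bool × Bool)) :=
  (Bw q c i).filter (fun w => ∀ a ∈ w.head?, a.1 = false)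

theorem Hw_card_aux (q c i : ℕ) : (Hw (q + 1) (c + 1) i).card = (Bw q (c + 1) i).card + (Bw q c i).card := by
  have : Hw (q + 1) (c + 1) i = (Bw q (c + 1) i).image (List.cons (false, false)) ∪
      (Bw q c i).image (List.cons (false, true)) := by
    ext w
    unfold Hw
    rw [Finset.mem_filter]
    cases w with
    | nil => simp [mem_Bw]
    | cons a w =>
      obtain ⟨o, cl⟩ := a
      cases o <;> cases cl <;> simp [mem_Bw, VV]
  rw [this, Finset.card_union_of_disjoint, Finset.card_image_of_injective _ List.cons_injective,
    Finset.card_image_of_injective _ List.cons_injective]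
  simp [Finset.disjoint_left]

theorem Hw_card (q c i : ℕ) (hq : 1 ≤ q) (hc : 1 ≤ c) :
    q * (Hw q c i).card = c * q.choose i * q.choose (i + c) := by
  obtain ⟨q, rfl⟩ := Nat.exists_eq_add_of_le' hq
  obtain ⟨c, rfl⟩ := Nat.exists_eq_add_of_le' hc
  have P : ∀ n k : ℕ, ((n + 1).choose (k + 1) : ℤ) = n.choose k + n.choose (k + 1) := by
    intro n k; exact_mod_cast Nat.choose_succ_succ n k
  have key : ((Hw (q + 1) (c + 1) i).card : ℤ) = q.choose i * (q + 1).choose (i + (c + 1)) -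
      (q + 1).choose i * q.choose (i + (c + 1)) := by
    rw [Hw_card_aux]
    cases q with
    | zero =>
      rcases c with _ | c <;> rcases i with _ | i <;>
        simp [Bw, Nat.choose_eq_zero_of_lt] 
    | succ q =>
      push_cast
      rw [Bw_card, Bw_card, ← add_assoc, P (q + 1) (i + c), P q (i + c)]
      ring
  have M : ∀ k : ℕ, ((q + 1 : ℕ) : ℤ) * q.choose k = ((q + 1 : ℕ) - k : ℤ) * (q + 1).choose k := by
    intro k
    have := Nat.choose_mul_succ_eq q k
    by_cases hk : k ≤ q + 1
    · zify [hk] at this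
      push_cast; linarith
    · rw [Nat.choose_eq_zero_of_lt (by omega), Nat.choose_eq_zero_of_lt (by omega)]; simp
  zify
  rw [key]
  have a := M i
  have b := M (i + (c + 1))
  push_cast at *
  linear_combination ((q + 1).choose (i + (c + 1)) : ℤ) * a - ((q + 1).choose i : ℤ) * b


theorem PRun.vv {S w S' L} (h : PRun S w S' L) : VV S.length (w.map Prod.snd) S'.length := by
  induction h with
  | nil S => simp [VV]
  | o _ ih => simpa [VV] using ih
  | m _ ih => simpa [VV] using ih
  | c _ ih => simpa [VV] using ih
  | s _ ih => simpa [VV] using ih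

theorem PRun.ex {w : List (ℤ × Bool × Bool)} : ∀ {S : List (List ℤ)} {k},
    VV S.length (w.map Prod.snd) k → ∃ S' L, PRun S w S' L ∧ S'.length = k := by
  induction w with
  | nil => intro S k h; exact ⟨S, [], .nil S, by simpa [VV] using h⟩
  | cons a w ih =>
    obtain ⟨x, o, c⟩ := a
    intro S k h
    rw [List.map_cons] at h
    cases o <;> cases c
    · cases S with
      | nil => simp [VV] at h
      | cons b S =>
        obtain ⟨S', L, h1, h2⟩ := ih (S := (b ++ [x]) :: S) (k := k) (by simpa [VV] using h)
        exact ⟨S', L, .m h1, h2⟩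
    · cases S with
      | nil => simp [VV] at h
      | cons b S =>
        obtain ⟨S', L, h1, h2⟩ := ih (S := S) (k := k) (by simpa [VV] using h)
        exact ⟨S', _, .c h1, h2⟩
    · obtain ⟨S', L, h1, h2⟩ := ih (S := [x] :: S) (k := k) (by simpa [VV] using h)
      exact ⟨S', L, .o h1, h2⟩
    · obtain ⟨S', L, h1, h2⟩ := ih (S := S) (k := k) (by simpa [VV] using h)
      exact ⟨S', _, .s h1, h2⟩

theorem PRun.det {S w S' L} (h : PRun S w S' L) : ∀ {S'' L'}, PRun S w S'' L' → S' = S'' ∧ L = L' := by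
  induction h with
  | nil S => intro S'' L' h; cases h; exact ⟨rfl, rfl⟩
  | o _ ih => intro S'' L' h; cases h with | o h => exact ih h
  | m _ ih => intro S'' L' h; cases h with | m h => exact ih h
  | c _ ih =>
    intro S'' L' h
    cases h with | c h => obtain ⟨rfl, rfl⟩ := ih h; exact ⟨rfl, rfl⟩
  | s _ ih =>
    intro S'' L' h
    cases h with | s h => obtain ⟨rfl, rfl⟩ := ih h; exact ⟨rfl, rfl⟩

theorem VV_append {w w' : List (Bool × Bool)} : ∀ {h k}, VV h (w ++ w') k ↔ ∃ m, VV h w m ∧ VV m w' k := by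
  induction w with
  | nil => intro h k; simp [VV]
  | cons a w ih =>
    obtain ⟨o, c⟩ := a
    intro h k
    cases h <;> cases o <;> cases c <;> simp [VV, ih]

theorem VV_single (a : Bool × Bool) (h k : ℕ) : VV h [a] k → VV k [a.swap] h := by
  obtain ⟨o, c⟩ := a
  cases o <;> cases c <;> cases h <;> cases k <;> simp [VV] <;> omega

def flipw (w : List (Bool × Bool)) : List (Bool × Bool) := (w.map Prod.swap).reverse

theorem flipw_flipw (w) : flipw (flipw w) = w := by
  simp [flipw, List.map_reverse]

theorem VV_flip {w : List (Bool × Bool)} : ∀ {h k}, VV h w k → VV k (flipw w) h := by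
  induction w with
  | nil => intro h k hh; simpa [VV, flipw, eq_comm] using hh
  | cons a w ih =>
    intro h k hh
    rw [← List.singleton_append, VV_append] at hh
    obtain ⟨m, h1, h2⟩ := hh
    have : flipw (a :: w) = flipw w ++ [a.swap] := by simp [flipw]
    rw [this, VV_append]
    exact ⟨m, ih h2, VV_single _ _ _ h1⟩

theorem PRun.closes {S w S' L} (h : PRun S w S' L) : L.length = (w.map Prod.snd).countP (fun a => a.2) := by
  induction h with
  | nil S => simp
  | o _ ih => simpa using ih
  | m _ ih => simpa using ih
  | c _ ih => simpa using ih
  | s _ ih => simpa using ih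

theorem PRun.opens {S w S' L} (h : PRun S w S' L) :
    L.length + S'.length = S.length + (w.map Prod.snd).countP (fun a => a.1) := by
  induction h with
  | nil S => simp
  | o _ ih => simp at *; omega
  | m _ ih => simp at *; omega
  | c _ ih => simp at *; omega
  | s _ ih => simp at *; omega

theorem PRun.perm {S w S' L} (h : PRun S w S' L) :
    (L.flatten ++ S'.flatten).Perm (S.flatten ++ w.map Prod.fst) := by
  rw [← Multiset.coe_eq_coe]
  induction h with
  | nil S => simp
  | o _ ih =>
    simp only [← Multiset.coe_add, ← Multiset.cons_coe, List.flatten_cons, List.map_cons, ← Multiset.singleton_add, Multiset.coe_nil, add_zero] at *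
    rw [ih]; abel
  | m _ ih =>
    simp only [← Multiset.coe_add, ← Multiset.cons_coe, List.flatten_cons, List.map_cons, ← Multiset.singleton_add, Multiset.coe_nil, add_zero] at *
    rw [ih]; abel
  | c _ ih =>
    simp only [← Multiset.coe_add, ← Multiset.cons_coe, List.flatten_cons, List.map_cons, ← Multiset.singleton_add, Multiset.coe_nil, add_zero] at *
    rw [add_assoc, ih]; abel
  | s _ ih =>
    simp only [← Multiset.coe_add, ← Multiset.cons_coe, List.flatten_cons, List.map_cons, ← Multiset.singleton_add, Multiset.coe_nil, add_zero] at *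
    rw [add_assoc, ih]; abel

theorem PRun.ne {S w S' L} (h : PRun S w S' L) : (∀ b ∈ S, b ≠ []) → (∀ b ∈ S', b ≠ []) ∧ ∀ b ∈ L, b ≠ [] := by
  induction h with
  | nil S => simp
  | o _ ih => intro h; exact ih (by simpa using h)
  | m _ ih => intro h; exact ih (by simp at h ⊢; exact h.2)
  | c _ ih => intro h; simp at h; have := ih h.2; simp; exact ⟨this.1, this.2⟩
  | s _ ih => intro h; have := ih h; simp; exact ⟨this.1, this.2⟩

/-- points of `w` outside `P` -/
theorem PRun.hasP {S w S' L} (P : ℤ → Bool) (h : PRun S w S' L) (hw : ∀ x ∈ w.map Prod.fst, P x = false) :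
    L.countP (fun b => b.any P) + S'.countP (fun b => b.any P) = S.countP (fun b => b.any P) := by
  induction h with
  | nil S => simp
  | o _ ih =>
    have h1 := hw _ (List.mem_cons_self)
    have := ih (fun x hx => hw x (List.mem_cons_of_mem _ hx))
    simp [List.countP_cons, h1] at *; omega
  | m _ ih =>
    have h1 := hw _ (List.mem_cons_self)
    have := ih (fun x hx => hw x (List.mem_cons_of_mem _ hx))
    simp [List.countP_cons, h1] at *; omega
  | c _ ih =>
    have h1 := hw _ (List.mem_cons_self)
    have := ih (fun x hx => hw x (List.mem_cons_of_mem _ hx))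
    simp [List.countP_cons, h1] at *; omega
  | s _ ih =>
    have h1 := hw _ (List.mem_cons_self)
    have := ih (fun x hx => hw x (List.mem_cons_of_mem _ hx))
    simp [List.countP_cons, h1] at *; omega

theorem PRun.last_mem {S w S' L} (h : PRun S w S' L) : ∀ b ∈ L, ∃ x ∈ b, x ∈ w.map Prod.fst := by
  induction h with
  | nil S => simp
  | o _ ih =>
    intro b hb; obtain ⟨x, h1, h2⟩ := ih b hb; exact ⟨x, h1, List.mem_cons_of_mem _ h2⟩
  | m _ ih =>
    intro b hb; obtain ⟨x, h1, h2⟩ := ih b hb; exact ⟨x, h1, List.mem_cons_of_mem _ h2⟩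
  | c _ ih =>
    intro b hb
    rcases List.mem_cons.1 hb with rfl | hb
    · exact ⟨_, by simp, List.mem_cons_self⟩
    obtain ⟨x, h1, h2⟩ := ih b hb; exact ⟨x, h1, List.mem_cons_of_mem _ h2⟩
  | s _ ih =>
    intro b hb
    rcases List.mem_cons.1 hb with rfl | hb
    · exact ⟨_, by simp, List.mem_cons_self⟩
    obtain ⟨x, h1, h2⟩ := ih b hb; exact ⟨x, h1, List.mem_cons_of_mem _ h2⟩

theorem PRun.pw {r : ℤ → ℤ → Prop} {S w S' L} (h : PRun S w S' L) :
    (∀ s ∈ S, s.Pairwise r) → (∀ s ∈ S, ∀ x ∈ s, ∀ z ∈ w.map Prod.fst, r x z) →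
    (w.map Prod.fst).Pairwise r → ∀ b ∈ L, b.Pairwise r := by
  induction h with
  | nil S => simp
  | @o S w S' Ls x _ ih =>
    intro h1 h2 h3
    rw [List.map_cons, List.pairwise_cons] at h3
    refine ih ?_ ?_ h3.2
    · intro s hs
      rcases List.mem_cons.1 hs with rfl | hs
      · simp
      · exact h1 s hs
    · intro s hs y hy z hz
      rcases List.mem_cons.1 hs with rfl | hs
      · obtain rfl : y = x := by simpa using hy
        exact h3.1 z hz
      · exact h2 s hs y hy z (List.mem_cons_of_mem _ hz)
  | @m S w S' Ls x b _ ih =>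
    intro h1 h2 h3
    rw [List.map_cons, List.pairwise_cons] at h3
    refine ih ?_ ?_ h3.2
    · intro s hs
      rcases List.mem_cons.1 hs with rfl | hs
      · rw [List.pairwise_append]
        refine ⟨h1 b (by simp), by simp, fun y hy z hz => ?_⟩
        obtain rfl : z = x := by simpa using hz
        exact h2 b (by simp) y hy z (by simp)
      · exact h1 s (List.mem_cons_of_mem _ hs)
    · intro s hs y hy z hz
      rcases List.mem_cons.1 hs with rfl | hs
      · rcases List.mem_append.1 hy with hy | hy
        · exact h2 b (by simp) y hy z (List.mem_cons_of_mem _ hz)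
        · obtain rfl : y = x := by simpa using hy
          exact h3.1 z hz
      · exact h2 s (List.mem_cons_of_mem _ hs) y hy z (List.mem_cons_of_mem _ hz)
  | @c S w S' Ls x b _ ih =>
    intro h1 h2 h3
    rw [List.map_cons, List.pairwise_cons] at h3
    intro s hs
    rcases List.mem_cons.1 hs with rfl | hs
    · rw [List.pairwise_append]
      refine ⟨h1 b (by simp), by simp, fun y hy z hz => ?_⟩
      obtain rfl : z = x := by simpa using hz
      exact h2 b (by simp) y hy z (by simp)
    · exact ih (fun s hs => h1 s (List.mem_cons_of_mem _ hs))
        (fun s hs y hy z hz => h2 s (List.mem_cons_of_mem _ hs) y hy z (List.mem_cons_of_mem _ hz)) h3.2 s hs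
  | @s S w S' Ls x _ ih =>
    intro h1 h2 h3
    rw [List.map_cons, List.pairwise_cons] at h3
    intro s hs
    rcases List.mem_cons.1 hs with rfl | hs
    · simp
    · exact ih h1 (fun s hs y hy z hz => h2 s hs y hy z (List.mem_cons_of_mem _ hz)) h3.2 s hs

theorem PRun.stack {S w S' L} (h : PRun S w S' L) : S' = [] → ∀ s ∈ S, ∃ t, t ≠ [] ∧ s ++ t ∈ L := by
  induction h with
  | nil S => rintro rfl; simp
  | @o S w S' Ls x _ ih =>
    intro e s hs; exact ih e s (List.mem_cons_of_mem _ hs)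
  | @m S w S' Ls x b _ ih =>
    intro e s hs
    rcases List.mem_cons.1 hs with rfl | hs
    · obtain ⟨t, h1, h2⟩ := ih e _ (List.mem_cons_self)
      exact ⟨x :: t, by simp, by simpa using h2⟩
    · exact ih e s (List.mem_cons_of_mem _ hs)
  | @c S w S' Ls x b _ ih =>
    intro e s hs
    rcases List.mem_cons.1 hs with rfl | hs
    · exact ⟨[x], by simp, by simp⟩
    · obtain ⟨t, h1, h2⟩ := ih e _ hs
      exact ⟨t, h1, List.mem_cons_of_mem _ h2⟩
  | @s S w S' Ls x _ ih =>
    intro e s hs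
    obtain ⟨t, h1, h2⟩ := ih e _ hs
    exact ⟨t, h1, List.mem_cons_of_mem _ h2⟩

theorem PRun.letters {S w S' L} (h : PRun S w S' L) : S' = [] → (∀ b ∈ S, b ≠ []) →
    ∀ z o c, (z, o, c) ∈ w →
    (o = true → ∃ t, z :: t ∈ L) ∧ (o = false → ∃ s y t, s ++ y :: z :: t ∈ L) ∧
    (c = true → ∃ s, s ++ [z] ∈ L) ∧ (c = false → ∃ s y t, s ++ z :: y :: t ∈ L) := by
  have up : ∀ (b : List ℤ) (L : List (List ℤ)) z (o c : Bool), ((o = true → ∃ t, z :: t ∈ L) ∧ (o = false → ∃ s y t, s ++ y :: z :: t ∈ L) ∧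
    (c = true → ∃ s, s ++ [z] ∈ L) ∧ (c = false → ∃ s y t, s ++ z :: y :: t ∈ L)) →
    ((o = true → ∃ t, z :: t ∈ b :: L) ∧ (o = false → ∃ s y t, s ++ y :: z :: t ∈ b :: L) ∧
    (c = true → ∃ s, s ++ [z] ∈ b :: L) ∧ (c = false → ∃ s y t, s ++ z :: y :: t ∈ b :: L)) := by
    rintro b L z o c ⟨h1, h2, h3, h4⟩
    refine ⟨fun h => ?_, fun h => ?_, fun h => ?_, fun h => ?_⟩
    · obtain ⟨t, ht⟩ := h1 h; exact ⟨t, List.mem_cons_of_mem _ ht⟩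
    · obtain ⟨s, y, t, ht⟩ := h2 h; exact ⟨s, y, t, List.mem_cons_of_mem _ ht⟩
    · obtain ⟨t, ht⟩ := h3 h; exact ⟨t, List.mem_cons_of_mem _ ht⟩
    · obtain ⟨s, y, t, ht⟩ := h4 h; exact ⟨s, y, t, List.mem_cons_of_mem _ ht⟩
  have nel : ∀ b : List ℤ, b ≠ [] → ∃ s y, b = s ++ [y] := fun b hb => by
    rcases List.eq_nil_or_concat' b with h | ⟨s, y, h⟩
    · exact absurd h hb
    · exact ⟨s, y, h⟩
  induction h with
  | nil S => simp
  | @o S w S' Ls x hr ih =>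
    intro e hS z o c hz
    have hS' : ∀ b ∈ [x] :: S, b ≠ [] := by simpa using hS
    rcases List.mem_cons.1 hz with hz | hz
    · obtain ⟨rfl, rfl, rfl⟩ : z = x ∧ o = true ∧ c = false := by simpa using hz
      obtain ⟨t, h1, h2⟩ := hr.stack e _ (List.mem_cons_self)
      refine ⟨fun _ => ⟨t, h2⟩, by simp, by simp, fun _ => ?_⟩
      cases t with
      | nil => exact absurd rfl h1
      | cons y t => exact ⟨[], y, t, h2⟩
    · exact ih e hS' z o c hz
  | @m S w S' Ls x b hr ih =>
    intro e hS z o c hz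
    have hS' : ∀ d ∈ (b ++ [x]) :: S, d ≠ [] := by simp at hS ⊢; exact hS.2
    rcases List.mem_cons.1 hz with hz | hz
    · obtain ⟨rfl, rfl, rfl⟩ : z = x ∧ o = false ∧ c = false := by simpa using hz
      obtain ⟨t, h1, h2⟩ := hr.stack e _ (List.mem_cons_self)
      obtain ⟨s, y, rfl⟩ := nel b (hS b (by simp))
      refine ⟨by simp, fun _ => ⟨s, y, t, by simpa using h2⟩, by simp, fun _ => ?_⟩
      cases t with
      | nil => exact absurd rfl h1
      | cons y' t => exact ⟨s ++ [y], y', t, by simpa using h2⟩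
    · exact ih e hS' z o c hz
  | @c S w S' Ls x b hr ih =>
    intro e hS z o c hz
    rcases List.mem_cons.1 hz with hz | hz
    · obtain ⟨rfl, rfl, rfl⟩ : z = x ∧ o = false ∧ c = true := by simpa using hz
      obtain ⟨s, y, rfl⟩ := nel b (hS b (by simp))
      refine ⟨by simp, fun _ => ⟨s, y, [], by simp⟩, fun _ => ⟨s ++ [y], by simp⟩, by simp⟩
    · exact up _ _ _ _ _ (ih e (fun b hb => hS b (List.mem_cons_of_mem _ hb)) z o c hz)
  | @s S w S' Ls x hr ih =>
    intro e hS z o c hz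
    rcases List.mem_cons.1 hz with hz | hz
    · obtain ⟨rfl, rfl, rfl⟩ : z = x ∧ o = true ∧ c = true := by simpa using hz
      exact ⟨fun _ => ⟨[], by simp⟩, by simp, fun _ => ⟨[], by simp⟩, by simp⟩
    · exact up _ _ _ _ _ (ih e hS z o c hz)

theorem read {r : ℤ → ℤ → Prop} (hr : ∀ x y, r x y → ¬ r y x) {τ : Equiv.Perm ℤ} {w L}
    (h : PRun [] w [] L) (hc : ∀ b ∈ L, Cyc τ b) (hp : (w.map Prod.fst).Pairwise r) {z o c}
    (hz : (z, o, c) ∈ w) : (o = true ↔ ¬ r (τ⁻¹ z) z) ∧ (c = true ↔ ¬ r z (τ z)) := by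
  have hir : ∀ x, ¬ r x x := fun x h => hr x x h h
  have hpw := h.pw (r := r) (by simp) (by simp) hp
  obtain ⟨h1, h2, h3, h4⟩ := h.letters rfl (by simp) z o c hz
  constructor
  · cases o
    · obtain ⟨s, y, t, ht⟩ := h2 rfl
      have e := Ch_next (hc _ ht).1
      have := hpw _ ht
      rw [List.pairwise_append] at this
      have := (List.pairwise_cons.1 this.2.1).1 z (by simp)
      rw [show τ⁻¹ z = y by rw [Equiv.Perm.inv_eq_iff_eq]; exact e.symm]
      simp [this]
    · obtain ⟨t, ht⟩ := h1 rfl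
      have := hpw _ ht
      simp only [true_iff]
      rcases List.eq_nil_or_concat' t with rfl | ⟨s, y, rfl⟩
      · have e : τ z = z := Cyc_last' (hc _ ht) rfl rfl
        rw [show τ⁻¹ z = z by rw [Equiv.Perm.inv_eq_iff_eq]; exact e.symm]
        exact hir z
      · have e : τ y = z := Cyc_last (hc _ ht)
        rw [show τ⁻¹ z = y by rw [Equiv.Perm.inv_eq_iff_eq]; exact e.symm]
        exact hr _ _ ((List.pairwise_cons.1 this).1 y (by simp))
  · cases c
    · obtain ⟨s, y, t, ht⟩ := h4 rfl
      have e := Ch_next (hc _ ht).1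
      have := hpw _ ht
      rw [List.pairwise_append] at this
      have := (List.pairwise_cons.1 this.2.1).1 y (by simp)
      simp [e, this]
    · obtain ⟨s, ht⟩ := h3 rfl
      have := hpw _ ht
      simp only [true_iff]
      cases s with
      | nil =>
        have e : τ z = z := Cyc_last' (hc _ ht) rfl rfl
        rw [e]; exact hir z
      | cons y s =>
        have e : τ z = y := Cyc_last (hc _ ht)
        rw [e]
        exact hr _ _ ((List.pairwise_cons.1 this).1 z (by simp))

theorem Cyc_det {τ τ' : Equiv.Perm ℤ} {b x} (h : Cyc τ b) (h' : Cyc τ' b) (hx : x ∈ b) : τ x = τ' x := by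
  obtain ⟨u, v, rfl⟩ := List.append_of_mem hx
  cases v with
  | nil =>
    cases u with
    | nil => rw [Cyc_last' h (y := x) (x := x) rfl rfl, Cyc_last' h' (y := x) (x := x) rfl rfl]
    | cons a u => rw [Cyc_last h, Cyc_last h']
  | cons y v => rw [Ch_next h.1, Ch_next h'.1]

open Classical in
theorem blocks_ncard {n : ℕ} (Pr : List ℤ → Prop) : ∀ L : List (List ℤ), SN n L.flatten → (∀ b ∈ L, b ≠ []) →
    {A : Set ℤ | ∃ b ∈ L, Pr b ∧ (A = {y | y ∈ b} ∨ A = {y | -y ∈ b})}.Finite ∧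
    {A : Set ℤ | ∃ b ∈ L, Pr b ∧ (A = {y | y ∈ b} ∨ A = {y | -y ∈ b})}.ncard =
      2 * L.countP (fun b => decide (Pr b)) := by
  intro L
  induction L with
  | nil => simp
  | cons b L ih =>
    intro hs hn
    rw [List.flatten_cons] at hs
    obtain ⟨f, i⟩ := ih (hs.sub (List.sublist_append_right _ _)) (fun b hb => hn b (List.mem_cons_of_mem _ hb))
    by_cases hb : Pr b
    · have e : {A : Set ℤ | ∃ d ∈ b :: L, Pr d ∧ (A = {y | y ∈ d} ∨ A = {y | -y ∈ d})} =
        insert {y | y ∈ b} (insert {y | -y ∈ b}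
          {A : Set ℤ | ∃ d ∈ L, Pr d ∧ (A = {y | y ∈ d} ∨ A = {y | -y ∈ d})}) := by
        ext A
        simp only [List.mem_cons, Set.mem_ofPred_eq, Set.mem_insert_iff]
        constructor
        · rintro ⟨d, rfl | hd, h1, h2⟩
          · tauto
          · right; right; exact ⟨d, hd, h1, h2⟩
        · rintro (h | h | ⟨d, hd, h1, h2⟩)
          · exact ⟨b, .inl rfl, hb, .inl h⟩
          · exact ⟨b, .inl rfl, hb, .inr h⟩
          · exact ⟨d, .inr hd, h1, h2⟩
      obtain ⟨x, hx⟩ := List.exists_mem_of_ne_nil b (hn b (by simp))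
      have key : ∀ d ∈ L, (x ∉ d) ∧ (-x ∉ d) := by
        intro d hd
        constructor
        · intro h
          have := hs.1
          rw [List.nodup_append] at this
          exact this.2.2 x hx x (List.mem_flatten.2 ⟨d, hd, h⟩) rfl
        · intro h
          exact hs.2.2 x (List.mem_append_left _ hx) (List.mem_append_right _ (List.mem_flatten.2 ⟨d, hd, h⟩))
      have hx' : -x ∉ b := fun h => hs.2.2 x (List.mem_append_left _ hx) (List.mem_append_left _ h)
      rw [e]
      refine ⟨(f.insert _).insert _, ?_⟩
      rw [Set.ncard_insert_of_notMem ?_ (f.insert _), Set.ncard_insert_of_notMem ?_ f, i, List.countP_cons]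
      · simp [hb]; ring
      · rintro ⟨d, hd, -, h | h⟩
        · have : -x ∈ {y | -y ∈ b} := by simpa using hx
          rw [h] at this; exact (key d hd).2 this
        · have : -x ∈ {y | -y ∈ b} := by simpa using hx
          rw [h] at this; exact (key d hd).1 (by simpa using this)
      · intro h
        have hxb : x ∈ {y | y ∈ b} := hx
        rcases h with h | ⟨d, hd, -, h | h⟩
        · rw [h] at hxb; exact hx' hxb
        · rw [h] at hxb; exact (key d hd).1 hxb
        · rw [h] at hxb; exact (key d hd).2 hxb
    · have e : {A : Set ℤ | ∃ d ∈ b :: L, Pr d ∧ (A = {y | y ∈ d} ∨ A = {y | -y ∈ d})} =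
          {A : Set ℤ | ∃ d ∈ L, Pr d ∧ (A = {y | y ∈ d} ∨ A = {y | -y ∈ d})} := by
        ext A
        simp only [List.mem_cons, Set.mem_ofPred_eq]
        constructor
        · rintro ⟨d, rfl | hd, h1, h2⟩
          · exact absurd h1 hb
          · exact ⟨d, hd, h1, h2⟩
        · rintro ⟨d, hd, h1, h2⟩; exact ⟨d, .inr hd, h1, h2⟩
      rw [e, List.countP_cons]
      simp [hb, f, i]


def cir (off m k : ℕ) : ℤ :=
  if k % (2 * m) < m then (off : ℤ) + (k % (2 * m) : ℕ) + 1
  else -((off : ℤ) + ((k % (2 * m) - m : ℕ) : ℤ) + 1)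

theorem cir_mod (off m k : ℕ) : cir off m (k % (2 * m)) = cir off m k := by
  unfold cir; rw [Nat.mod_mod]

theorem cir_congr {off m k j : ℕ} (h : k ≡ j [MOD 2 * m]) : cir off m k = cir off m j := by
  rw [← cir_mod, h, cir_mod]

theorem cir_inj {off m k j : ℕ} (hm : 1 ≤ m) (h : cir off m k = cir off m j) : k ≡ j [MOD 2 * m] := by
  unfold cir at h
  have h1 := Nat.mod_lt k (show 0 < 2 * m by omega)
  have h2 := Nat.mod_lt j (show 0 < 2 * m by omega)
  unfold Nat.ModEq
  split_ifs at h <;> omega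

theorem cir_neg {off m : ℕ} (k : ℕ) (hm : 1 ≤ m) : cir off m (k + m) = - cir off m k := by
  have h1 := Nat.mod_lt k (show 0 < 2 * m by omega)
  by_cases h : k % (2 * m) < m
  · have e : (k + m) % (2 * m) = k % (2 * m) + m := by
      rw [Nat.add_mod, Nat.mod_eq_of_lt (show m < 2 * m by omega), Nat.mod_eq_of_lt (by omega)]
    unfold cir
    rw [e, if_neg (by omega), if_pos h]
    simp
  · have e : (k + m) % (2 * m) = k % (2 * m) - m := by
      rw [Nat.add_mod, Nat.mod_eq_of_lt (show m < 2 * m by omega)]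
      rw [show k % (2 * m) + m = (k % (2 * m) - m) + 2 * m by omega, Nat.add_mod_right,
        Nat.mod_eq_of_lt (by omega)]
    unfold cir
    rw [e, if_pos (by omega), if_neg h]
    simp

theorem cir_mem {off m : ℕ} (k : ℕ) (hm : 1 ≤ m) : (off : ℤ) < |cir off m k| ∧ |cir off m k| ≤ off + m := by
  have h1 := Nat.mod_lt k (show 0 < 2 * m by omega)
  unfold cir
  split_ifs with h
  · rw [abs_of_nonneg (by positivity)]; omega
  · rw [abs_neg, abs_of_nonneg (by positivity)]; omega

theorem cir_surj {off m : ℕ} {x : ℤ} (h : (off : ℤ) < |x| ∧ |x| ≤ off + m) : ∃ k < 2 * m, cir off m k = x := by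
  rcases le_or_gt 0 x with h0 | h0
  · rw [abs_of_nonneg h0] at h
    refine ⟨(x - off - 1).toNat, by omega, ?_⟩
    unfold cir
    rw [Nat.mod_eq_of_lt (by omega), if_pos (by omega)]; omega
  · rw [abs_of_neg h0] at h
    refine ⟨(-x - off - 1).toNat + m, by omega, ?_⟩
    unfold cir
    rw [Nat.mod_eq_of_lt (by omega), if_neg (by omega)]; omega

theorem cir_list (off m : ℕ) : ((List.range m).map fun i => ((off : ℤ) + (i : ℤ) + 1)) ++
      ((List.range m).map fun i => -((off : ℤ) + (i : ℤ) + 1)) = (List.range (2 * m)).map (cir off m) := by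
  have e : (do let a ← List.range m; pure (a : ℤ)) = (List.range m).map (fun a : ℕ => (a : ℤ)) := by
    simp [List.map_eq_flatMap]
  rw [e]
  apply List.ext_getElem
  · simp; omega
  · intro k h1 h2
    simp at h1 h2
    rw [List.getElem_append]
    simp only [List.length_map, List.length_range, List.getElem_map, List.getElem_range]
    unfold cir
    rw [Nat.mod_eq_of_lt (by omega)]
    split_ifs <;> rfl

theorem cir_nodup (off m : ℕ) : ((List.range (2 * m)).map (cir off m)).Nodup := by
  refine List.Nodup.map_on ?_ List.nodup_range
  intro x hx y hy h
  simp at hx hy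
  have := cir_inj (by omega) h
  unfold Nat.ModEq at this
  rwa [Nat.mod_eq_of_lt hx, Nat.mod_eq_of_lt hy] at this

theorem cir_form {off m : ℕ} (k : ℕ) (hm : 1 ≤ m) :
    ((List.range (2 * m)).map (cir off m)).formPerm (cir off m k) = cir off m (k + 1) := by
  have h1 := Nat.mod_lt k (show 0 < 2 * m by omega)
  have := List.formPerm_apply_getElem _ (cir_nodup off m) (k % (2 * m)) (by simpa using h1)
  simp only [List.getElem_map, List.getElem_range, List.length_map, List.length_range] at this
  rw [cir_mod, cir_mod] at this
  rw [this]
  exact cir_congr (Nat.ModEq.add_right 1 (Nat.mod_modEq _ _))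

theorem gamma_eq (p q : ℕ) : gammaPQ p q = ((List.range (2 * p)).map (cir 0 p)).formPerm *
    ((List.range (2 * q)).map (cir p q)).formPerm := by
  unfold gammaPQ
  rw [← cir_list, ← cir_list]
  simp

theorem mem_cl {off m : ℕ} {x : ℤ} (hm : 1 ≤ m) : x ∈ (List.range (2 * m)).map (cir off m) ↔
    (off : ℤ) < |x| ∧ |x| ≤ off + m := by
  constructor
  · intro h
    obtain ⟨k, -, rfl⟩ := List.mem_map.1 h
    exact cir_mem k hm
  · intro h
    obtain ⟨k, hk, rfl⟩ := cir_surj h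
    exact List.mem_map.2 ⟨k, by simpa using hk, rfl⟩

theorem gamma_P {p q : ℕ} (hp : 1 ≤ p) (hq : 1 ≤ q) (k : ℕ) : gammaPQ p q (cir 0 p k) = cir 0 p (k + 1) := by
  rw [gamma_eq, Equiv.Perm.mul_apply,
    List.formPerm_apply_of_notMem (l := (List.range (2 * q)).map (cir p q)), cir_form k hp]
  rw [mem_cl hq]
  have := cir_mem (off := 0) k hp
  push_cast at this
  omega

theorem gamma_Q {p q : ℕ} (hp : 1 ≤ p) (hq : 1 ≤ q) (k : ℕ) : gammaPQ p q (cir p q k) = cir p q (k + 1) := by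
  rw [gamma_eq, Equiv.Perm.mul_apply, cir_form k hq, List.formPerm_apply_of_notMem]
  rw [mem_cl hp]
  have := cir_mem (off := p) (k + 1) hq
  push_cast at this ⊢
  omega

theorem sS_iff {p : ℕ} {x : ℤ} : x ∈ signedSet p ↔ ((0 : ℕ) : ℤ) < |x| ∧ |x| ≤ ((0 : ℕ) : ℤ) + p := by
  unfold signedSet
  simp

theorem iS_iff {p q : ℕ} {x : ℤ} : x ∈ innerSet p q ↔ (p : ℤ) < |x| ∧ |x| ≤ (p : ℤ) + q := Iff.rfl

theorem ss_or {p q : ℕ} {x : ℤ} : x ∈ signedSet (p + q) ↔ x ∈ signedSet p ∨ x ∈ innerSet p q := by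
  rw [sS_iff, sS_iff, iS_iff]; push_cast; omega

theorem ss_disj {p q : ℕ} {x : ℤ} (h : x ∈ signedSet p) (h' : x ∈ innerSet p q) : False := by
  rw [sS_iff] at h; rw [iS_iff] at h'; push_cast at h; omega

theorem cP_mem {p : ℕ} (hp : 1 ≤ p) (k : ℕ) : cir 0 p k ∈ signedSet p := sS_iff.2 (cir_mem k hp)
theorem cQ_mem {p q : ℕ} (hq : 1 ≤ q) (k : ℕ) : cir p q k ∈ innerSet p q := cir_mem k hq

theorem gamma_inB {p q : ℕ} (hp : 1 ≤ p) (hq : 1 ≤ q) : inB (p + q) (gammaPQ p q) := by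
  have out : ∀ x : ℤ, x ∉ signedSet (p + q) → gammaPQ p q x = x := by
    intro x hx
    rw [ss_or] at hx
    push Not at hx
    rw [gamma_eq, Equiv.Perm.mul_apply,
      List.formPerm_apply_of_notMem (l := (List.range (2 * q)).map (cir p q)),
      List.formPerm_apply_of_notMem]
    · rw [mem_cl hp, ← sS_iff]; exact hx.1
    · rw [mem_cl hq]; exact hx.2
  refine ⟨fun x => ?_, out⟩
  by_cases hx : x ∈ signedSet (p + q)
  · rcases ss_or.1 hx with h | h
    · obtain ⟨k, -, rfl⟩ := cir_surj (sS_iff.1 h)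
      rw [← cir_neg k hp, gamma_P hp hq, gamma_P hp hq, ← cir_neg _ hp]
      congr 1; ring
    · obtain ⟨k, -, rfl⟩ := cir_surj h
      rw [← cir_neg k hq, gamma_Q hp hq, gamma_Q hp hq, ← cir_neg _ hq]
      congr 1; ring
  · rw [out x hx, out (-x) (fun h => hx (ss_neg.1 h))]

def rel (p q : ℕ) (u v : ℤ) : Prop := (u ∈ signedSet p ∧ v ∈ innerSet p q) ∨
  (∃ k j, 0 < j ∧ j < p ∧ u = cir 0 p k ∧ v = cir 0 p (k + j)) ∨
  (∃ k j, 0 < j ∧ j < q ∧ u = cir p q k ∧ v = cir p q (k + j))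

theorem cir_asymm {off m k j k' j' : ℕ} (hj : 0 < j) (hj2 : j < m) (hj' : j' < m)
    (h1 : cir off m k = cir off m (k' + j')) (h2 : cir off m (k + j) = cir off m k') : False := by
  have a := cir_inj (by omega) h1
  have b := cir_inj (by omega) h2
  have c : k' + (j' + j) ≡ k' + 0 [MOD 2 * m] := by
    have := (Nat.ModEq.add_right j a).symm.trans b
    rwa [add_assoc] at this
  have := Nat.ModEq.add_left_cancel' _ c
  unfold Nat.ModEq at this
  rw [Nat.mod_eq_of_lt (by omega), Nat.mod_eq_of_lt (by omega)] at this
  omega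

theorem rel_asymm {p q : ℕ} (hp : 1 ≤ p) (hq : 1 ≤ q) (u v : ℤ) (h : rel p q u v) : ¬ rel p q v u := by
  intro h'
  rcases h with ⟨h1, h2⟩ | ⟨k, j, hj, hj2, rfl, rfl⟩ | ⟨k, j, hj, hj2, rfl, rfl⟩ <;>
  rcases h' with ⟨h1', h2'⟩ | ⟨k', j', hj', hj2', e1, e2⟩ | ⟨k', j', hj', hj2', e1, e2⟩
  · exact ss_disj h1 h2'
  · rw [e1] at h2; exact ss_disj (cP_mem hp _) h2
  · rw [e2] at h1; exact ss_disj h1 (cQ_mem hq _)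
  · exact ss_disj (cP_mem hp _) h2'
  · exact cir_asymm hj hj2 hj2' e2 e1
  · have := cP_mem hp k; rw [e2] at this; exact ss_disj this (cQ_mem hq _)
  · exact ss_disj h1' (cQ_mem hq _)
  · have := cQ_mem (p := p) hq k; rw [e2] at this; exact ss_disj (cP_mem hp _) this
  · exact cir_asymm hj hj2 hj2' e2 e1

theorem sP_neg {p : ℕ} {x : ℤ} : -x ∈ signedSet p ↔ x ∈ signedSet p := by rw [sS_iff, sS_iff, abs_neg]
theorem sQ_neg {p q : ℕ} {x : ℤ} : -x ∈ innerSet p q ↔ x ∈ innerSet p q := by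
  rw [iS_iff, iS_iff, abs_neg]

theorem rel_neg {p q : ℕ} (hp : 1 ≤ p) (hq : 1 ≤ q) (u v : ℤ) (h : rel p q u v) : rel p q (-u) (-v) := by
  rcases h with ⟨h1, h2⟩ | ⟨k, j, hj, hj2, rfl, rfl⟩ | ⟨k, j, hj, hj2, rfl, rfl⟩
  · exact .inl ⟨sP_neg.2 h1, sQ_neg.2 h2⟩
  · refine .inr (.inl ⟨k + p, j, hj, hj2, (cir_neg _ hp).symm, ?_⟩)
    rw [← cir_neg _ hp]; congr 1; ring
  · refine .inr (.inr ⟨k + q, j, hj, hj2, (cir_neg _ hq).symm, ?_⟩)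
    rw [← cir_neg _ hq]; congr 1; ring

def lP (p a : ℕ) : List ℤ := (List.range p).map fun j => cir 0 p (a + p + 1 + j)
def lQ (p q b : ℕ) : List ℤ := (List.range q).map fun j => cir p q (b + j)

theorem lP_mem {p a x} (hp : 1 ≤ p) (h : x ∈ lP p a) : x ∈ signedSet p := by
  obtain ⟨j, -, rfl⟩ := List.mem_map.1 h; exact cP_mem hp _
theorem lQ_mem {p q b x} (hq : 1 ≤ q) (h : x ∈ lQ p q b) : x ∈ innerSet p q := by
  obtain ⟨j, -, rfl⟩ := List.mem_map.1 h; exact cQ_mem hq _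

theorem pw_range {r : ℤ → ℤ → Prop} {f : ℕ → ℤ} {m : ℕ} (h : ∀ i j, i < j → j < m → r (f i) (f j)) :
    ((List.range m).map f).Pairwise r := by
  rw [List.pairwise_map]
  refine List.Pairwise.imp_of_mem ?_ List.pairwise_lt_range
  intro i j _ hj hij
  exact h i j hij (by simpa using hj)

theorem l_pw {p q : ℕ} (hp : 1 ≤ p) (hq : 1 ≤ q) (a b : ℕ) : (lP p a ++ lQ p q b).Pairwise (rel p q) := by
  rw [List.pairwise_append]
  refine ⟨pw_range fun i j h1 h2 => ?_, pw_range fun i j h1 h2 => ?_, fun x hx y hy =>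
    .inl ⟨lP_mem hp hx, lQ_mem hq hy⟩⟩
  · refine .inr (.inl ⟨a + p + 1 + i, j - i, by omega, by omega, rfl, ?_⟩)
    congr 1; omega
  · refine .inr (.inr ⟨b + i, j - i, by omega, by omega, rfl, ?_⟩)
    congr 1; omega

theorem cir_noneg {off m d i j : ℕ} (hi : i < m) (hj : j < m) : cir off m (d + i) ≠ - cir off m (d + j) := by
  intro h
  rw [← cir_neg _ (by omega)] at h
  have := cir_inj (by omega) h
  rw [add_assoc] at this
  have := Nat.ModEq.add_left_cancel' _ this
  unfold Nat.ModEq at this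
  rw [Nat.mod_eq_of_lt (by omega), Nat.mod_eq_of_lt (by omega)] at this
  omega

theorem l_SN {p q : ℕ} (hp : 1 ≤ p) (hq : 1 ≤ q) (a b : ℕ) : SN (p + q) (lP p a ++ lQ p q b) := by
  refine ⟨?_, fun x hx => ?_, fun x hx hx' => ?_⟩
  · refine (l_pw hp hq a b).imp ?_
    rintro x y h rfl
    exact rel_asymm hp hq _ _ h h
  · rw [ss_or]
    rcases List.mem_append.1 hx with h | h
    · exact .inl (lP_mem hp h)
    · exact .inr (lQ_mem hq h)
  · rcases List.mem_append.1 hx with h | h <;> rcases List.mem_append.1 hx' with h' | h'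
    · obtain ⟨i, hi, rfl⟩ := List.mem_map.1 h
      obtain ⟨j, hj, e⟩ := List.mem_map.1 h'
      exact cir_noneg (by simpa using hj) (by simpa using hi) e
    · exact ss_disj (lP_mem hp h) (sQ_neg.1 (lQ_mem hq h'))
    · exact ss_disj (sP_neg.1 (lP_mem hp h')) (lQ_mem hq h)
    · obtain ⟨i, hi, rfl⟩ := List.mem_map.1 h
      obtain ⟨j, hj, e⟩ := List.mem_map.1 h'
      exact cir_noneg (by simpa using hj) (by simpa using hi) e

theorem arc_cover {off m : ℕ} (d k : ℕ) (hm : 1 ≤ m) : ∃ i < m, cir off m k = cir off m (d + i) ∨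
    -cir off m k = cir off m (d + i) := by
  -- pick r with d + r ≡ k
  set r := (k + (2 * m * d - d)) % (2 * m) with hr
  have hlt : r < 2 * m := Nat.mod_lt _ (by omega)
  have hd : d ≤ 2 * m * d := Nat.le_mul_of_pos_left _ (by omega)
  have hk : d + r ≡ k [MOD 2 * m] := by
    have h1 : d + r ≡ d + (k + (2 * m * d - d)) [MOD 2 * m] := Nat.ModEq.add_left _ (Nat.mod_modEq _ _)
    have h2 : d + (k + (2 * m * d - d)) = k + 2 * m * d := by omega
    rw [h2] at h1
    exact h1.trans (by simp [Nat.ModEq])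
  by_cases h : r < m
  · exact ⟨r, h, .inl (cir_congr hk.symm)⟩
  · refine ⟨r - m, by omega, .inr ?_⟩
    rw [← cir_congr (off := off) hk, ← cir_neg _ hm]
    refine cir_congr ?_
    rw [show d + r + m = d + (r - m) + 2 * m by omega]
    simp [Nat.ModEq]

theorem l_cover {p q : ℕ} (hp : 1 ≤ p) (hq : 1 ≤ q) (a b : ℕ) {x : ℤ} (hx : x ∈ signedSet (p + q)) :
    x ∈ lP p a ++ lQ p q b ∨ -x ∈ lP p a ++ lQ p q b := by
  rcases ss_or.1 hx with h | h
  · obtain ⟨k, -, rfl⟩ := cir_surj (sS_iff.1 h)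
    obtain ⟨i, hi, h | h⟩ := arc_cover (off := 0) (a + p + 1) k hp
    · exact .inl (List.mem_append_left _ (List.mem_map.2 ⟨i, by simpa using hi, h.symm⟩))
    · exact .inr (List.mem_append_left _ (List.mem_map.2 ⟨i, by simpa using hi, h.symm⟩))
  · obtain ⟨k, -, rfl⟩ := cir_surj h
    obtain ⟨i, hi, h | h⟩ := arc_cover (off := p) b k hq
    · exact .inl (List.mem_append_right _ (List.mem_map.2 ⟨i, by simpa using hi, h.symm⟩))
    · exact .inr (List.mem_append_right _ (List.mem_map.2 ⟨i, by simpa using hi, h.symm⟩))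

theorem Ch_range {τ : Equiv.Perm ℤ} {f : ℕ → ℤ} (h : ∀ k, τ (f k) = f (k + 1)) (m : ℕ) :
    Ch τ ((List.range m).map f) := by
  unfold Ch
  induction m with
  | zero => simp
  | succ m ih =>
    rw [List.range_succ, List.map_append, List.isChain_append]
    refine ⟨ih, by simp, ?_⟩
    intro x hx y hy
    cases m with
    | zero => simp at hx
    | succ m =>
      rw [List.range_succ, List.map_append] at hx
      simp at hx hy
      subst hx hy
      exact h m

theorem lP_eq {p : ℕ} (hp : 1 ≤ p) (a : ℕ) : lP p a =
    ((List.range (p - 1)).map fun j => cir 0 p (a + p + 1 + j)) ++ [cir 0 p a] := by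
  obtain ⟨p, rfl⟩ := Nat.exists_eq_add_of_le' hp
  unfold lP
  rw [List.range_succ, List.map_append]
  simp only [List.map_cons, List.map_nil, Nat.add_sub_cancel]
  congr 2
  refine cir_congr ?_
  rw [show a + (p + 1) + 1 + p = a + 2 * (p + 1) by ring]
  simp [Nat.ModEq]

theorem lQ_eq {p q : ℕ} (hq : 1 ≤ q) (b : ℕ) : lQ p q b =
    ((List.range (q - 1)).map fun j => cir p q (b + j)) ++ [- cir p q (b + 2 * q - 1)] := by
  obtain ⟨q, rfl⟩ := Nat.exists_eq_add_of_le' hq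
  unfold lQ
  rw [List.range_succ, List.map_append]
  simp only [List.map_cons, List.map_nil, Nat.add_sub_cancel]
  congr 2
  rw [show b + 2 * (q + 1) - 1 = b + q + (q + 1) by omega, cir_neg _ hq, neg_neg]

theorem lP_head {p : ℕ} (hp : 1 ≤ p) (a : ℕ) : (lP p a).head? = some (cir 0 p (a + p + 1)) := by
  obtain ⟨p, rfl⟩ := Nat.exists_eq_add_of_le' hp
  simp [lP, List.range_succ_eq_map]

theorem lQ_head {p q : ℕ} (hq : 1 ≤ q) (b : ℕ) : (lQ p q b).head? = some (cir p q b) := by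
  obtain ⟨q, rfl⟩ := Nat.exists_eq_add_of_le' hq
  simp [lQ, List.range_succ_eq_map]

theorem cut_cyc {p q : ℕ} (hp : 1 ≤ p) (hq : 1 ≤ q) (a b : ℕ) :
    Cyc (gammaPQ p q * rf (cir 0 p a) (cir p q (b + 2 * q - 1))) (lP p a ++ lQ p q b) := by
  have hs := l_SN hp hq a b
  set x := cir 0 p a with hx
  set z := cir p q (b + 2 * q - 1) with hz
  have hxl : x ∈ lP p a := by rw [lP_eq hp]; simp [hx]
  have hzl : -z ∈ lQ p q b := by rw [lQ_eq hq]; simp [hz]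
  have hxm := cP_mem hp a
  have hzm := cQ_mem (p := p) hq (b + 2 * q - 1)
  rw [← hx] at hxm
  rw [← hz] at hzm
  have hx0 : x ≠ 0 := hxm.1
  have hz0 : z ≠ 0 := by
    rintro h; rw [h] at hzm; have := hzm.1; simp at this; omega
  have key : ∀ y ∈ lP p a ++ lQ p q b, y ≠ x → y ≠ -z →
      (gammaPQ p q * rf x z) y = gammaPQ p q y := by
    intro y hy h1 h2
    rw [Equiv.Perm.mul_apply, rf_ne _ _ _ h1]
    · intro e
      exact hs.2.2 y hy (e ▸ List.mem_append_right _ hzl)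
    · rintro rfl
      exact hs.2.2 x (List.mem_append_left _ hxl) hy
    · exact h2
  rw [Cyc_app (by rw [lP_eq hp]; simp) (by rw [lQ_eq hq]; simp)]
  refine ⟨?_, ?_, ?_, ?_⟩
  · rw [lP_eq hp]
    refine Ch_congr (w := gammaPQ p q) ?_ ?_
    · rw [← lP_eq hp]
      exact Ch_range (f := fun j => cir 0 p (a + p + 1 + j)) (fun k => gamma_P hp hq _) _
    · intro y hy
      have hy' : y ∈ lP p a := by rw [lP_eq hp]; exact List.mem_append_left _ hy
      refine key y (List.mem_append_left _ hy') ?_ ?_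
      · rintro rfl
        have := (hs.sub (List.sublist_append_left _ _)).1
        rw [lP_eq hp, List.nodup_append] at this
        exact this.2.2 _ hy _ (by simp [hx]) rfl
      · rintro rfl
        exact ss_disj (lP_mem hp hy') (lQ_mem hq hzl)
  · rw [lQ_eq hq]
    refine Ch_congr (w := gammaPQ p q) ?_ ?_
    · rw [← lQ_eq hq]
      exact Ch_range (f := fun j => cir p q (b + j)) (fun k => gamma_Q hp hq _) _
    · intro y hy
      have hy' : y ∈ lQ p q b := by rw [lQ_eq hq]; exact List.mem_append_left _ hy
      refine key y (List.mem_append_right _ hy') ?_ ?_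
      · rintro rfl
        exact ss_disj hxm (lQ_mem hq hy')
      · rintro rfl
        have := (hs.sub (List.sublist_append_right _ _)).1
        rw [lQ_eq hq, List.nodup_append] at this
        exact this.2.2 _ hy _ (by simp [hz]) rfl
  · intro u hu v hv
    rw [lQ_head hq] at hv
    rw [lP_eq hp, List.getLast?_concat] at hu
    simp at hu hv
    subst hu hv
    rw [Equiv.Perm.mul_apply, ← hx, rf_left _ _ hx0, hz, gamma_Q hp hq]
    refine cir_congr ?_
    rw [show b + 2 * q - 1 + 1 = b + 2 * q by omega]
    simp [Nat.ModEq]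
  · intro u hu v hv
    rw [lP_head hp] at hv
    rw [lQ_eq hq, List.getLast?_concat] at hu
    simp at hu hv
    subst hu hv
    rw [Equiv.Perm.mul_apply, ← hz, rf_odd _ _ _ hx0 hz0, rf_right _ _ hz0, (gamma_inB hp hq).1, hx,
      gamma_P hp hq, ← cir_neg _ hp]
    congr 1; ring


theorem FV_gamma {p q : ℕ} (hp : 1 ≤ p) (hq : 1 ≤ q) {v} (hv : v ∈ FV (p + q) (gammaPQ p q)) : v = 0 := by
  have hv' := hv
  rw [mem_FV] at hv
  have hP : ∀ m k, v (cir 0 p (k + m)) = v (cir 0 p k) := by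
    intro m k
    induction m with
    | zero => simp
    | succ m ih => rw [← ih, ← add_assoc, ← gamma_P hp hq, hv.2]
  have hQ : ∀ m k, v (cir p q (k + m)) = v (cir p q k) := by
    intro m k
    induction m with
    | zero => simp
    | succ m ih => rw [← ih, ← add_assoc, ← gamma_Q hp hq, hv.2]
  have ho := (mem_Vn.1 hv.1)
  funext x
  by_cases hx : x ∈ signedSet (p + q)
  · rcases ss_or.1 hx with h | h
    · obtain ⟨k, -, rfl⟩ := cir_surj (sS_iff.1 h)
      have := hP p k
      rw [cir_neg _ hp, ho.1] at this
      simp; linarith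
    · obtain ⟨k, -, rfl⟩ := cir_surj h
      have := hQ q k
      rw [cir_neg _ hq, ho.1] at this
      simp; linarith
  · exact ho.2 x hx

structure Rr (p q a b : ℕ) (τ : Equiv.Perm ℤ) (w : List (ℤ × Bool × Bool)) (L : List (List ℤ)) : Prop where
  run : PRun [] w [] L
  pts : w.map Prod.fst = lP p a ++ lQ p q b
  cyc : ∀ d ∈ L, Cyc τ d

theorem Rr_fwd {p q : ℕ} (hp : 1 ≤ p) (hq : 1 ≤ q) {a b : ℕ} {τ} (hτ : τ ∈ SncB p q)
    (h : τ (cir 0 p a) = cir p q b) : ∃ w L, Rr p q a b τ w L := by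
  have hle := (leB_iff hτ.1 (gamma_inB hp hq)).1 hτ.2
  have h1 : gammaPQ p q (cir p q (b + 2 * q - 1)) = τ (cir 0 p a) := by
    rw [h, gamma_Q hp hq]
    refine cir_congr ?_
    rw [show b + 2 * q - 1 + 1 = b + 2 * q by omega]
    simp [Nat.ModEq]
  have h2 : cir p q (b + 2 * q - 1) ≠ cir 0 p a := by
    intro e
    have := cQ_mem (p := p) hq (b + 2 * q - 1)
    rw [e] at this
    exact ss_disj (cP_mem hp a) this
  obtain ⟨h3, h4⟩ := leD_peel hτ.1 (gamma_inB hp hq) hle h1 h2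
  obtain ⟨w, L, e1, e2, e3⟩ := extract_all hτ.1 h4 h3 (cut_cyc hp hq a b) (l_SN hp hq a b)
  exact ⟨w, L, e3, e1, e2⟩

theorem Rr_bwd {p q : ℕ} (hp : 1 ≤ p) (hq : 1 ≤ q) {a b : ℕ} {w L} (h : PRun [] w [] L)
    (hw : w.map Prod.fst = lP p a ++ lQ p q b) : ∃ τ ∈ SncB p q, Rr p q a b τ w L := by
  have hx : cir 0 p a ∈ signedSet (p + q) := ss_or.2 (.inl (cP_mem hp a))
  have hz : cir p q (b + 2 * q - 1) ∈ signedSet (p + q) := ss_or.2 (.inr (cQ_mem hq _))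
  have hW := inB_mul (gamma_inB hp hq) (inB_rf hx hz)
  have hc := cut_cyc hp hq a b
  have hs := l_SN hp hq a b
  obtain ⟨τ, h1, h2, h3, -⟩ := build (n := p + q) h _ rfl hW (by simpa [hw] using hc) (by simpa [hw] using hs)
  refine ⟨τ, ⟨h1, (leB_iff h1 (gamma_inB hp hq)).2 ?_⟩, h, hw, h3⟩
  refine leD_up hx.1 hz.1 h2 (dV_lt ?_ (ind (lP p a ++ lQ p q b)) (ind_mem hW hc hs) ?_)
  · intro v hv
    rw [FV_gamma hp hq hv]; exact Submodule.zero_mem _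
  · intro hv
    have := congrFun (FV_gamma hp hq hv) (cir 0 p a)
    unfold ind at this
    rw [if_pos (by rw [lP_eq hp]; simp)] at this
    simp at this

theorem Rr.perm {p q a b τ w L} (h : Rr p q a b τ w L) : L.flatten.Perm (lP p a ++ lQ p q b) := by
  have := h.run.perm
  rw [h.pts] at this
  simpa using this

theorem Rr.cover {p q a b τ w L} (hp : 1 ≤ p) (hq : 1 ≤ q) (h : Rr p q a b τ w L) {x}
    (hx : x ∈ signedSet (p + q)) : ∃ d ∈ L, x ∈ d ∨ -x ∈ d := by
  rcases l_cover hp hq a b hx with h1 | h1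
  · rw [← h.perm.mem_iff, List.mem_flatten] at h1
    obtain ⟨d, h1, h2⟩ := h1; exact ⟨d, h1, .inl h2⟩
  · rw [← h.perm.mem_iff, List.mem_flatten] at h1
    obtain ⟨d, h1, h2⟩ := h1; exact ⟨d, h1, .inr h2⟩

theorem Rr.SN {p q a b τ w L} (hp : 1 ≤ p) (hq : 1 ≤ q) (h : Rr p q a b τ w L) : SN (p + q) L.flatten :=
  (l_SN hp hq a b).perm h.perm.symm

theorem Rr.SNd {p q a b τ w L} (hp : 1 ≤ p) (hq : 1 ≤ q) (h : Rr p q a b τ w L) {d} (hd : d ∈ L) :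
    _root_.SN (p + q) d := (h.SN hp hq).sub (List.sublist_flatten_of_mem hd)

theorem Rr.uniq {p q a b τ τ' w L L'} (hp : 1 ≤ p) (hq : 1 ≤ q) (h : Rr p q a b τ w L) (h' : Rr p q a b τ' w L')
    (hτ : inB (p + q) τ) (hτ' : inB (p + q) τ') : τ = τ' := by
  obtain ⟨-, rfl⟩ := h.run.det h'.run
  ext x
  by_cases hx : x ∈ signedSet (p + q)
  · obtain ⟨d, hd, h1 | h1⟩ := h.cover hp hq hx
    · rw [Cyc_det (h.cyc d hd) (h'.cyc d hd) h1]
    · have := Cyc_det (h.cyc d hd) (h'.cyc d hd) h1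
      rw [hτ.1, hτ'.1] at this; omega
  · rw [hτ.2 x hx, hτ'.2 x hx]

theorem Rr.read {p q a b τ w L w' L'} (hp : 1 ≤ p) (hq : 1 ≤ q) (h : Rr p q a b τ w L)
    (h' : Rr p q a b τ w' L') : w = w' := by
  have hp1 := l_pw hp hq a b
  have r1 := fun z o c => _root_.read (rel_asymm hp hq) h.run h.cyc (by rw [h.pts]; exact hp1) (z := z) (o := o) (c := c)
  have r2 := fun z o c => _root_.read (rel_asymm hp hq) h'.run h'.cyc (by rw [h'.pts]; exact hp1) (z := z) (o := o) (c := c)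
  have e : w.map Prod.fst = w'.map Prod.fst := by rw [h.pts, h'.pts]
  have hlen : w.length = w'.length := by simpa using congrArg List.length e
  apply List.ext_getElem hlen
  intro k h1 h2
  have ek : (w[k]).1 = (w'[k]).1 := by
    have : (w.map Prod.fst)[k]'(by simpa using h1) = (w'.map Prod.fst)[k]'(by simpa using h2) := by
      simp only [e]
    simpa using this
  have m1 := List.getElem_mem h1
  have m2 := List.getElem_mem h2
  generalize w[k] = u at *
  generalize w'[k] = u' at *
  obtain ⟨z, o, c⟩ := u
  obtain ⟨z', o', c'⟩ := u'
  simp only at ek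
  subst ek
  have a1 := r1 _ _ _ m1
  have a2 := r2 _ _ _ m2
  have b1 := a1.1.trans a2.1.symm
  have b2 := a1.2.trans a2.2.symm
  rw [Bool.eq_iff_iff.2 b1, Bool.eq_iff_iff.2 b2]

theorem Cyc_neg {n τ d} (hτ : inB n τ) (h : Cyc τ d) : Cyc τ (d.map (fun x => -x)) := by
  refine ⟨?_, ?_⟩
  · unfold Ch
    rw [List.isChain_map]
    exact h.1.imp fun x y e => by rw [hτ.1, e]
  · intro x hx y hy
    rw [List.getLast?_map] at hx
    rw [List.head?_map] at hy
    simp only [Option.mem_def, Option.map_eq_some_iff] at hx hy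
    obtain ⟨x', h1, rfl⟩ := hx
    obtain ⟨y', h2, rfl⟩ := hy
    rw [hτ.1, h.2 x' h1 y' h2]

theorem mem_mapneg {d : List ℤ} {x : ℤ} : x ∈ d.map (fun x => -x) ↔ -x ∈ d := by
  simp only [List.mem_map]
  constructor
  · rintro ⟨y, hy, rfl⟩; simpa using hy
  · intro h; exact ⟨-x, h, by simp⟩

/-- key lemma: blocks are lists sorted for `rel`. -/
theorem Rr.good {p q a b τ w L} (hp : 1 ≤ p) (hq : 1 ≤ q) (h : Rr p q a b τ w L) (hτ : inB (p + q) τ) {x}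
    (hx : x ∈ signedSet (p + q)) : ∃ d, x ∈ d ∧ d.Pairwise (rel p q) ∧ Cyc τ d ∧ (∀ y ∈ d, -y ∉ d) ∧
      ∀ y ∈ d, y ∈ signedSet (p + q) := by
  have hpw := h.run.pw (r := rel p q) (by simp) (by simp) (by rw [h.pts]; exact l_pw hp hq a b)
  obtain ⟨d, hd, h1 | h1⟩ := h.cover hp hq hx
  · exact ⟨d, h1, hpw d hd, h.cyc d hd, (h.SNd hp hq hd).2.2, (h.SNd hp hq hd).2.1⟩
  · refine ⟨d.map (fun x => -x), mem_mapneg.2 h1, ?_, Cyc_neg hτ (h.cyc d hd), ?_, ?_⟩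
    · rw [List.pairwise_map]
      exact (hpw d hd).imp (rel_neg hp hq _ _)
    · intro y hy hy'
      rw [mem_mapneg] at hy hy'
      exact (h.SNd hp hq hd).2.2 _ hy hy'
    · intro y hy
      rw [mem_mapneg] at hy
      exact ss_neg.1 ((h.SNd hp hq hd).2.1 _ hy)

theorem good_neg {τ : Equiv.Perm ℤ} {d x} (h : Cyc τ d) (hx : x ∈ d) (hd : ∀ y ∈ d, -y ∉ d) :
    negSet (permOrbit τ x) ≠ permOrbit τ x := by
  rw [Cyc_orbit h hx]
  intro e
  have : x ∈ {y | y ∈ d} := hx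
  rw [← e] at this
  exact hd x hx this

theorem Rr.omega {p q a b τ w L} (hp : 1 ≤ p) (hq : 1 ≤ q) (h : Rr p q a b τ w L) (hτ : inB (p + q) τ) :
    omegaTilde (p + q) τ = orbitsOn (p + q) τ := by
  have key : ∀ A ∈ orbitsOn (p + q) τ, negSet A ≠ A := by
    rintro A ⟨x, hx, rfl⟩
    obtain ⟨d, h1, h2, h3, h4, -⟩ := h.good hp hq hτ hx
    exact good_neg h3 h1 h4
  unfold omegaTilde
  ext A
  constructor
  · rintro (h | ⟨rfl, x, B, ⟨hB, hB'⟩, -⟩)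
    · exact h.1
    · exact absurd hB' (key B hB)
  · intro h
    exact .inl ⟨h, key A h⟩

theorem Rr.orbits {p q a b τ w L} (hp : 1 ≤ p) (hq : 1 ≤ q) (h : Rr p q a b τ w L) (hτ : inB (p + q) τ) (A : Set ℤ) :
    A ∈ orbitsOn (p + q) τ ↔ ∃ d ∈ L, (A = {y | y ∈ d} ∨ A = {y | -y ∈ d}) := by
  have e : ∀ d : List ℤ, {y | y ∈ d.map (fun x => -x)} = {y : ℤ | -y ∈ d} := by
    intro d; ext y; exact mem_mapneg
  constructor
  · rintro ⟨x, hx, rfl⟩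
    obtain ⟨d, hd, h1 | h1⟩ := h.cover hp hq hx
    · exact ⟨d, hd, .inl (Cyc_orbit (h.cyc d hd) h1)⟩
    · refine ⟨d, hd, .inr ?_⟩
      rw [Cyc_orbit (Cyc_neg hτ (h.cyc d hd)) (mem_mapneg.2 h1), e]
  · rintro ⟨d, hd, h1⟩
    obtain ⟨x, hx⟩ := List.exists_mem_of_ne_nil d ((h.run.ne (by simp)).2 d hd)
    have hxs := (h.SNd hp hq hd).2.1 x hx
    rcases h1 with rfl | rfl
    · exact ⟨x, hxs, (Cyc_orbit (h.cyc d hd) hx).symm⟩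
    · refine ⟨-x, ss_neg.2 hxs, ?_⟩
      rw [Cyc_orbit (Cyc_neg hτ (h.cyc d hd)) (mem_mapneg.2 (by simpa using hx)), e]

theorem Rr.inj {p q a b τ w L a' b' τ' w' L'} (hp : 1 ≤ p) (hq : 1 ≤ q) (h : Rr p q a b τ w L)
    (hτ : inB (p + q) τ) (h' : Rr p q a' b' τ' w' L') (hτ' : inB (p + q) τ')
    (e : omegaTilde (p + q) τ = omegaTilde (p + q) τ') : τ = τ' := by
  rw [h.omega hp hq hτ, h'.omega hp hq hτ'] at e
  ext x
  by_cases hx : x ∈ signedSet (p + q)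
  · obtain ⟨d, h1, h2, h3, h4, -⟩ := h.good hp hq hτ hx
    obtain ⟨d', h1', h2', h3', h4', -⟩ := h'.good hp hq hτ' hx
    have hA : permOrbit τ x ∈ orbitsOn (p + q) τ' := by rw [← e]; exact ⟨x, hx, rfl⟩
    obtain ⟨y, hy, ey⟩ := hA
    obtain ⟨d2, k1, k2, k3, k4, -⟩ := h'.good hp hq hτ' hy
    have hx2 : x ∈ permOrbit τ' y := by rw [← ey, Cyc_orbit h3 h1]; exact h1
    rw [Cyc_orbit k3 k1] at hx2 ey
    rw [← Cyc_orbit k3 hx2, Cyc_orbit h3 h1, Cyc_orbit h3' h1'] at ey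
    have nd : ∀ d : List ℤ, d.Pairwise (rel p q) → d.Nodup := fun d hd => hd.imp (by
      rintro u v huv rfl
      exact rel_asymm hp hq _ _ huv huv)
    have hperm : d.Perm d' := by
      rw [List.perm_ext_iff_of_nodup (nd d h2) (nd d' h2')]
      intro u
      exact Set.ext_iff.1 ey u
    have : d = d' := List.Perm.eq_of_pairwise (fun u v _ _ huv hvu => absurd hvu (rel_asymm hp hq _ _ huv)) h2 h2' hperm
    subst this
    rw [Cyc_det h3 h3' h1]
  · rw [hτ.2 x hx, hτ'.2 x hx]


open Classical in
theorem Rr.half {p q a b τ w L} (hp : 1 ≤ p) (hq : 1 ≤ q) (h : Rr p q a b τ w L) (hτ : inB (p + q) τ)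
    (Q : Set ℤ → Prop) (hQ : ∀ d : List ℤ, Q {y | -y ∈ d} ↔ Q {y | y ∈ d}) :
    {A | A ∈ omegaTilde (p + q) τ ∧ negSet A ≠ A ∧ Q A}.Finite ∧
    {A | A ∈ omegaTilde (p + q) τ ∧ negSet A ≠ A ∧ Q A}.ncard =
      2 * L.countP (fun d => decide (Q {y | y ∈ d})) := by
  have key : ∀ A ∈ orbitsOn (p + q) τ, negSet A ≠ A := by
    rintro A ⟨x, hx, rfl⟩
    obtain ⟨d, h1, h2, h3, h4, -⟩ := h.good hp hq hτ hx
    exact good_neg h3 h1 h4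
  have e : {A | A ∈ omegaTilde (p + q) τ ∧ negSet A ≠ A ∧ Q A} =
      {A : Set ℤ | ∃ d ∈ L, Q {y | y ∈ d} ∧ (A = {y | y ∈ d} ∨ A = {y | -y ∈ d})} := by
    rw [h.omega hp hq hτ]
    ext A
    constructor
    · rintro ⟨h1, h2, h3⟩
      obtain ⟨d, hd, h4⟩ := (h.orbits hp hq hτ A).1 h1
      refine ⟨d, hd, ?_, h4⟩
      rcases h4 with rfl | rfl
      · exact h3
      · exact (hQ d).1 h3
    · rintro ⟨d, hd, h1, h2⟩
      have hA := (h.orbits hp hq hτ A).2 ⟨d, hd, h2⟩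
      refine ⟨hA, key A hA, ?_⟩
      rcases h2 with rfl | rfl
      · exact h1
      · exact (hQ d).2 h1
  rw [e]
  exact blocks_ncard (n := p + q) (fun d => Q {y | y ∈ d}) L (h.SN hp hq) ((h.run.ne (by simp)).2)

theorem Rr.split {p q a b τ w L} (h : Rr p q a b τ w L) : ∃ w1 w2 Sm L1 L2, w = w1 ++ w2 ∧
    PRun [] w1 Sm L1 ∧ PRun Sm w2 [] L2 ∧ L = L1 ++ L2 ∧ w1.map Prod.fst = lP p a ∧
    w2.map Prod.fst = lQ p q b := by
  have hr := h.run
  rw [← List.take_append_drop p w] at hr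
  obtain ⟨Sm, L1, L2, h1, h2, h3⟩ := hr.decomp
  refine ⟨w.take p, w.drop p, Sm, L1, L2, (List.take_append_drop p w).symm, h1, h2, h3, ?_, ?_⟩
  · rw [List.map_take, h.pts, List.take_append_of_le_length (by simp [lP]), List.take_of_length_le (by simp [lP])]
  · rw [List.map_drop, h.pts]
    exact List.drop_left' (by simp [lP])

open Classical in
theorem Rr.stats {p q a b τ w1 w2 Sm L1 L2} (hp : 1 ≤ p) (hq : 1 ≤ q) (hτ : inB (p + q) τ)
    (h1 : PRun [] w1 Sm L1) (h2 : PRun Sm w2 [] L2)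
    (e1 : w1.map Prod.fst = lP p a) (e2 : w2.map Prod.fst = lQ p q b)
    (h : Rr p q a b τ (w1 ++ w2) (L1 ++ L2)) :
    connectivity p q (omegaTilde (p + q) τ) = Sm.length ∧
    extPairs p (omegaTilde (p + q) τ) = (w1.map Prod.snd).countP (fun a => a.2) ∧
    intPairs p q (omegaTilde (p + q) τ) = (w2.map Prod.snd).countP (fun a => a.1) ∧
    {A | A ∈ omegaTilde (p + q) τ ∧ negSet A ≠ A ∧ (A ∩ signedSet p).Nonempty ∧
      (A ∩ innerSet p q).Nonempty}.Finite ∧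
    {A | A ∈ omegaTilde (p + q) τ ∧ negSet A ≠ A ∧ (A ∩ signedSet p).Nonempty ∧
      (A ∩ innerSet p q).Nonempty}.ncard = 2 * Sm.length := by
  have hm1 := h1.perm
  rw [e1, List.flatten_nil, List.nil_append] at hm1
  have hL1 : ∀ d ∈ L1, ∀ x ∈ d, x ∈ signedSet p := fun d hd x hx => lP_mem hp (a := a)
    (hm1.mem_iff.1 (List.mem_append_left _ (List.mem_flatten.2 ⟨d, hd, hx⟩)))
  have hSm : ∀ d ∈ Sm, ∀ x ∈ d, x ∈ signedSet p := fun d hd x hx => lP_mem hp (a := a)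
    (hm1.mem_iff.1 (List.mem_append_right _ (List.mem_flatten.2 ⟨d, hd, hx⟩)))
  have hne1 := h1.ne (by simp)
  have hne2 := h2.ne hne1.1
  have hL2 : ∀ d ∈ L2, ∃ x ∈ d, x ∈ innerSet p q := by
    intro d hd
    obtain ⟨x, hx, hx'⟩ := h2.last_mem d hd
    rw [e2] at hx'
    exact ⟨x, hx, lQ_mem hq hx'⟩
  have hmem2 : ∀ d ∈ L2, ∀ x ∈ d, x ∈ signedSet p ∨ x ∈ innerSet p q := by
    intro d hd x hx
    have := h2.perm
    rw [e2] at this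
    have := this.mem_iff.1 (List.mem_append_left _ (List.mem_flatten.2 ⟨d, hd, hx⟩))
    rcases List.mem_append.1 this with h | h
    · obtain ⟨s, hs, hs'⟩ := List.mem_flatten.1 h
      exact .inl (hSm s hs x hs')
    · exact .inr (lQ_mem hq h)
  have hcount := h2.hasP (fun x => decide (x ∈ signedSet p)) (by
    intro x hx
    rw [e2] at hx
    rw [decide_eq_false_iff_not]
    exact fun h => ss_disj h (lQ_mem hq hx))
  have hSc : Sm.countP (fun b => b.any (fun x => decide (x ∈ signedSet p))) = Sm.length := by
    rw [List.countP_eq_length]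
    intro s hs
    obtain ⟨x, hx⟩ := List.exists_mem_of_ne_nil s (hne1.1 s hs)
    rw [List.any_eq_true]
    exact ⟨x, hx, by simpa using hSm s hs x hx⟩
  rw [hSc, List.countP_nil, add_zero] at hcount
  have hC := h.half hp hq hτ (fun A => (A ∩ signedSet p).Nonempty ∧ (A ∩ innerSet p q).Nonempty) (by
    intro d
    have : ∀ (B : Set ℤ), (∀ x, -x ∈ B ↔ x ∈ B) → (({y | -y ∈ d} ∩ B).Nonempty ↔ ({y | y ∈ d} ∩ B).Nonempty) := by
      intro B hB
      constructor
      · rintro ⟨x, h1, h2⟩; exact ⟨-x, h1, (hB x).2 h2⟩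
      · rintro ⟨x, h1, h2⟩; exact ⟨-x, by simpa using h1, (hB x).2 h2⟩
    rw [this _ (fun x => sP_neg), this _ (fun x => sQ_neg)])
  have hE := h.half hp hq hτ (fun A => A ⊆ signedSet p) (by
    intro d
    constructor
    · intro h x hx; exact sP_neg.1 (h (by simpa using hx))
    · intro h x hx; exact sP_neg.1 (h hx))
  have hI := h.half hp hq hτ (fun A => A ⊆ innerSet p q) (by
    intro d
    constructor
    · intro h x hx; exact sQ_neg.1 (h (by simpa using hx))
    · intro h x hx; exact sQ_neg.1 (h hx))
  have cC : (L1 ++ L2).countP (fun d => decide (({y | y ∈ d} ∩ signedSet p).Nonempty ∧ ({y | y ∈ d} ∩ innerSet p q).Nonempty)) = Sm.length := by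
    rw [List.countP_append, ← hcount]
    have a1 : L1.countP (fun d => decide (({y | y ∈ d} ∩ signedSet p).Nonempty ∧ ({y | y ∈ d} ∩ innerSet p q).Nonempty)) = 0 := by
      rw [List.countP_eq_zero]
      intro d hd
      rw [decide_eq_true_iff]
      rintro ⟨-, x, h1, h2⟩
      exact ss_disj (hL1 d hd x h1) h2
    rw [a1, zero_add]
    refine List.countP_congr fun d hd => ?_
    rw [decide_eq_true_iff, List.any_eq_true]
    constructor
    · rintro ⟨⟨x, h1, h2⟩, -⟩; exact ⟨x, h1, by simpa using h2⟩
    · rintro ⟨x, h1, h2⟩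
      obtain ⟨y, hy, hy'⟩ := hL2 d hd
      exact ⟨⟨x, h1, by simpa using h2⟩, ⟨y, hy, hy'⟩⟩
  have cE : (L1 ++ L2).countP (fun d => decide ({y | y ∈ d} ⊆ signedSet p)) = L1.length := by
    have a1 : L1.countP (fun d => decide ({y | y ∈ d} ⊆ signedSet p)) = L1.length := by
      rw [List.countP_eq_length]
      intro d hd
      rw [decide_eq_true_iff]
      exact fun x hx => hL1 d hd x hx
    have a2 : L2.countP (fun d => decide ({y | y ∈ d} ⊆ signedSet p)) = 0 := by
      rw [List.countP_eq_zero]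
      intro d hd
      rw [decide_eq_true_iff]
      intro h
      obtain ⟨x, h1, h2⟩ := hL2 d hd
      exact ss_disj (h h1) h2
    rw [List.countP_append, a1, a2, add_zero]
  have cI : (L1 ++ L2).countP (fun d => decide ({y | y ∈ d} ⊆ innerSet p q)) = (w2.map Prod.snd).countP (fun a => a.1) := by
    have a1 : L1.countP (fun d => decide ({y | y ∈ d} ⊆ innerSet p q)) = 0 := by
      rw [List.countP_eq_zero]
      intro d hd
      rw [decide_eq_true_iff]
      intro h
      obtain ⟨x, hx⟩ := List.exists_mem_of_ne_nil d (hne1.2 d hd)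
      exact ss_disj (hL1 d hd x hx) (h hx)
    have a2 : L2.countP (fun d => decide ({y | y ∈ d} ⊆ innerSet p q)) =
        L2.countP (fun d => decide ¬ ((d.any (fun x => decide (x ∈ signedSet p))) = true)) := by
      refine List.countP_congr fun d hd => ?_
      rw [decide_eq_true_iff, decide_eq_true_iff, List.any_eq_true]
      constructor
      · rintro h ⟨x, h1, h2⟩
        exact ss_disj (by simpa using h2) (h h1)
      · intro h x hx
        rcases hmem2 d hd x hx with h' | h'
        · exact absurd ⟨x, hx, by simpa using h'⟩ h
        · exact h'
    rw [List.countP_append, a1, a2, zero_add]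
    have b1 := List.length_eq_countP_add_countP (fun d : List ℤ => d.any (fun x => decide (x ∈ signedSet p))) (l := L2)
    have b2 := h2.opens
    simp only [List.length_nil, add_zero] at b2
    rw [hcount] at b1
    omega
  have hC2 := hC.2.trans (b := _) (c := 2 * Sm.length) (by rw [← cC]; congr!)
  refine ⟨?_, ?_, ?_, hC.1, hC2⟩
  · unfold connectivity
    rw [hC2]; omega
  · unfold extPairs
    rw [hE.2, cE, h1.closes]; omega
  · unfold intPairs
    rw [hI.2, cI]; omega


def Wd (p q a b : ℕ) (u : List (Bool × Bool) × List (Bool × Bool)) : List (ℤ × Bool × Bool) :=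
  (lP p a).zip (flipw u.1) ++ (lQ p q b).zip u.2

theorem zip_fs {α β : Type} (w : List (α × β)) : (w.map Prod.fst).zip (w.map Prod.snd) = w := by
  induction w with
  | nil => rfl
  | cons a w ih => simp [ih]

theorem flipw_length (w) : (flipw w).length = w.length := by simp [flipw]

theorem flipw_count2 (w : List (Bool × Bool)) : (flipw w).countP (fun a => a.2) = w.countP (fun a => a.1) := by
  unfold flipw
  rw [List.countP_reverse, List.countP_map]; rfl

theorem lP_length (p a : ℕ) : (lP p a).length = p := by simp [lP]
theorem lQ_length (p q b : ℕ) : (lQ p q b).length = q := by simp [lQ]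

theorem mem_Hw {q c i w} : w ∈ Hw q c i ↔ (w.length = q ∧ VV c w 0 ∧ w.countP (fun a => a.1) = i) ∧
    ∀ a ∈ w.head?, a.1 = false := by
  unfold Hw
  rw [Finset.mem_filter, mem_Bw]

theorem cross1 {w x o Sm L1} (h : PRun [] (w ++ [(x, o, false)]) Sm L1) : ∃ b S, Sm = (b ++ [x]) :: S := by
  obtain ⟨S', L1, L2, h1, h2, -⟩ := h.decomp
  cases h2 with
  | o h => cases h; exact ⟨[], _, rfl⟩
  | m h => cases h; exact ⟨_, _, rfl⟩

theorem cross2 {w y cl d S L} (h : PRun (d :: S) ((y, false, cl) :: w) [] L) : ∃ t, d ++ y :: t ∈ L := by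
  cases h with
  | m h =>
    obtain ⟨t, -, ht⟩ := h.stack rfl _ List.mem_cons_self
    exact ⟨t, by simpa using ht⟩
  | c h => exact ⟨[], List.mem_cons_self⟩

/-- target set with a marked crossing -/
def Tab (p q c e i a b : ℕ) : Set (Equiv.Perm ℤ) :=
  {τ | (τ ∈ SncB p q ∧ connectivity p q (omegaTilde (p + q) τ) = c ∧
    extPairs p (omegaTilde (p + q) τ) = e ∧ intPairs p q (omegaTilde (p + q) τ) = i) ∧
    τ (cir 0 p a) = cir p q b}

theorem Tab_A {p q c e i a b : ℕ} (hp : 1 ≤ p) (hq : 1 ≤ q) {u} (hu : u ∈ Hw p c e ×ˢ Hw q c i) :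
    ∃ τ ∈ Tab p q c e i a b, ∃ L, Rr p q a b τ (Wd p q a b u) L := by
  obtain ⟨u1, u2⟩ := u
  obtain ⟨hu1, hu2⟩ := Finset.mem_product.1 hu
  simp only at hu1 hu2
  rw [mem_Hw] at hu1 hu2
  obtain ⟨⟨l1, v1, c1⟩, o1⟩ := hu1
  obtain ⟨⟨l2, v2, c2⟩, o2⟩ := hu2
  set w1 := (lP p a).zip (flipw u1) with hw1
  set w2 := (lQ p q b).zip u2 with hw2
  have f1 : w1.map Prod.fst = lP p a := List.map_fst_zip (by rw [lP_length, flipw_length, l1])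
  have s1 : w1.map Prod.snd = flipw u1 := List.map_snd_zip (by rw [lP_length, flipw_length, l1])
  have f2 : w2.map Prod.fst = lQ p q b := List.map_fst_zip (by rw [lQ_length, l2])
  have s2 : w2.map Prod.snd = u2 := List.map_snd_zip (by rw [lQ_length, l2])
  obtain ⟨Sm, L1, r1, hS⟩ := PRun.ex (w := w1) (S := []) (k := c) (by rw [s1]; exact VV_flip v1)
  obtain ⟨S', L2, r2, hS'⟩ := PRun.ex (w := w2) (S := Sm) (k := 0) (by rw [s2, hS]; exact v2)
  obtain rfl := List.length_eq_zero_iff.1 hS'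
  obtain ⟨τ, hτ, hR⟩ := Rr_bwd hp hq (r1.comp r2) (a := a) (b := b) (by rw [List.map_append, f1, f2])
  obtain ⟨t1, t2, t3, -⟩ := Rr.stats hp hq hτ.1 r1 r2 f1 f2 hR
  refine ⟨τ, ⟨⟨hτ, t1.trans hS, ?_, ?_⟩, ?_⟩, _, hR⟩
  · rw [t2, s1, flipw_count2, c1]
  · rw [t3, s2, c2]
  · obtain ⟨⟨o, cl⟩, u1', rfl⟩ := List.exists_cons_of_length_pos (show 0 < u1.length by omega)
    obtain ⟨⟨o', cl'⟩, u2', rfl⟩ := List.exists_cons_of_length_pos (show 0 < u2.length by omega)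
    have : o = false := o1 _ rfl
    subst this
    have : o' = false := o2 _ rfl
    subst this
    have e1 : ∃ w, w1 = w ++ [(cir 0 p a, cl, false)] := by
      rw [hw1, lP_eq hp, show flipw ((false, cl) :: u1') = flipw u1' ++ [(cl, false)] by simp [flipw],
        List.zip_append (by rw [flipw_length]; simp at l1 ⊢; omega)]
      exact ⟨_, rfl⟩
    have e2 : ∃ w, w2 = (cir p q b, false, cl') :: w := by
      have := lQ_head (p := p) hq b
      obtain ⟨y, t, ht⟩ := List.exists_cons_of_length_pos (show 0 < (lQ p q b).length by rw [lQ_length]; omega)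
      rw [ht] at this
      simp at this
      rw [hw2, ht, this]
      exact ⟨_, rfl⟩
    obtain ⟨w, e1⟩ := e1
    obtain ⟨w', e2⟩ := e2
    rw [e1] at r1
    rw [e2] at r2
    obtain ⟨d, S, rfl⟩ := cross1 r1
    obtain ⟨t, ht⟩ := cross2 r2
    have := (hR.cyc _ (List.mem_append_right _ ht)).1
    rw [List.append_assoc] at this
    exact Ch_next this

theorem Tab_B {p q c e i a b : ℕ} (hp : 1 ≤ p) (hq : 1 ≤ q) {τ} (h : τ ∈ Tab p q c e i a b) :
    ∃ u ∈ Hw p c e ×ˢ Hw q c i, ∃ L, Rr p q a b τ (Wd p q a b u) L := by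
  obtain ⟨⟨hτ, h1, h2, h3⟩, hx⟩ := h
  obtain ⟨w, L, hR⟩ := Rr_fwd hp hq hτ hx
  obtain ⟨w1, w2, Sm, L1, L2, rfl, r1, r2, rfl, f1, f2⟩ := hR.split
  obtain ⟨t1, t2, t3, -⟩ := Rr.stats hp hq hτ.1 r1 r2 f1 f2 hR
  have rd := fun z o c => _root_.read (rel_asymm hp hq) hR.run hR.cyc
    (by rw [hR.pts]; exact l_pw hp hq a b) (z := z) (o := o) (c := c)
  have hrel : rel p q (cir 0 p a) (cir p q b) := .inl ⟨cP_mem hp a, cQ_mem hq b⟩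
  have hx' : τ⁻¹ (cir p q b) = cir 0 p a := by rw [← hx]; simp
  have z1 : (lP p a).zip (w1.map Prod.snd) = w1 := by rw [← f1, zip_fs]
  have z2 : (lQ p q b).zip (w2.map Prod.snd) = w2 := by rw [← f2, zip_fs]
  have len1 : w1.length = p := by simpa [lP_length] using congrArg List.length f1
  have len2 : w2.length = q := by simpa [lQ_length] using congrArg List.length f2
  refine ⟨(flipw (w1.map Prod.snd), w2.map Prod.snd), ?_, L1 ++ L2, ?_⟩
  · rw [Finset.mem_product, mem_Hw, mem_Hw]
    have vv1 := r1.vv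
    have vv2 := r2.vv
    rw [← t1, h1] at vv1 vv2
    refine ⟨⟨⟨by simp [flipw_length, len1], VV_flip vv1, ?_⟩, ?_⟩, ⟨by simp [len2], vv2, by rw [← t3, h3]⟩, ?_⟩
    · rw [← flipw_count2, flipw_flipw, ← t2, h2]
    · rcases List.eq_nil_or_concat' w1 with rfl | ⟨w1', ⟨z, o, cl⟩, rfl⟩
      · simp at len1; omega
      rw [lP_eq hp, List.map_append] at f1
      obtain ⟨-, f1'⟩ := List.append_inj' f1 (by simp)
      simp only [List.map_cons, List.map_nil, List.cons.injEq, and_true] at f1'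
      subst f1'
      have := (rd (cir 0 p a) o cl (by simp)).2
      rw [hx] at this
      intro y hy
      simp [flipw] at hy
      rw [← hy]
      simpa [hrel] using this
    · rcases w2 with _ | ⟨⟨z, o, cl⟩, w2'⟩
      · simp at len2; omega
      have f2' := lQ_head (p := p) hq b
      rw [← f2] at f2'
      simp at f2'
      subst f2'
      have := (rd (cir p q b) o cl (by simp)).1
      rw [hx'] at this
      intro y hy
      simp at hy
      rw [← hy]
      simpa [hrel] using this
  · unfold Wd
    simp only [flipw_flipw]
    rw [z1, z2]
    exact hR

theorem Wd_inj {p q c e i a b : ℕ} {u u'} (hu : u ∈ Hw p c e ×ˢ Hw q c i) (hu' : u' ∈ Hw p c e ×ˢ Hw q c i)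
    (h : Wd p q a b u = Wd p q a b u') : u = u' := by
  obtain ⟨u1, u2⟩ := u
  obtain ⟨u1', u2'⟩ := u'
  rw [Finset.mem_product, mem_Hw, mem_Hw] at hu hu'
  obtain ⟨⟨⟨l1, -⟩, -⟩, ⟨l2, -⟩, -⟩ := hu
  obtain ⟨⟨⟨l1', -⟩, -⟩, ⟨l2', -⟩, -⟩ := hu'
  simp only at l1 l2 l1' l2'
  unfold Wd at h
  obtain ⟨h1, h2⟩ := List.append_inj h (by simp [flipw_length, l1, l1'])
  have h1 := congrArg (List.map Prod.snd) h1
  have h2 := congrArg (List.map Prod.snd) h2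
  simp only at h1 h2
  rw [List.map_snd_zip (by rw [lP_length, flipw_length, l1]), List.map_snd_zip (by rw [lP_length, flipw_length, l1'])] at h1
  rw [List.map_snd_zip (by rw [lQ_length, l2]), List.map_snd_zip (by rw [lQ_length, l2'])] at h2
  rw [h2, ← flipw_flipw u1, h1, flipw_flipw]

theorem Tab_card {p q : ℕ} (c e i a b : ℕ) (hp : 1 ≤ p) (hq : 1 ≤ q) :
    (Tab p q c e i a b).Finite ∧ (Tab p q c e i a b).ncard = (Hw p c e).card * (Hw q c i).card := by
  have hA := fun u (hu : u ∈ Hw p c e ×ˢ Hw q c i) => Tab_A (a := a) (b := b) hp hq hu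
  choose! f hf g hg using hA
  have im : Tab p q c e i a b = f '' ((Hw p c e ×ˢ Hw q c i : Finset _) : Set _) := by
    ext τ
    constructor
    · intro h
      obtain ⟨u, hu, L, hL⟩ := Tab_B hp hq h
      exact ⟨u, hu, (hg u hu).uniq hp hq hL (hf u hu).1.1.1 h.1.1.1⟩
    · rintro ⟨u, hu, rfl⟩
      exact hf u hu
  rw [im]
  refine ⟨(Finset.finite_toSet _).image _, ?_⟩
  rw [Set.InjOn.ncard_image, Set.ncard_coe_finset, Finset.card_product]
  intro u hu u' hu' h
  have h1 := hg u hu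
  have h2 := hg u' hu'
  rw [h] at h1
  exact Wd_inj hu hu' (h1.read hp hq h2)


theorem inB_maps {n τ} (h : inB n τ) {x} (hx : x ∈ signedSet n) : τ x ∈ signedSet n := by
  by_contra h'
  have := τ.injective (h.2 _ h')
  rw [this] at h'
  exact h' hx

theorem exists_cross {p q : ℕ} {τ} (hτ : inB (p + q) τ) {u v} (hu : u ∈ signedSet p) (hv : v ∈ innerSet p q)
    (huv : v ∈ permOrbit τ u) : ∃ x ∈ permOrbit τ u, x ∈ signedSet p ∧ τ x ∈ innerSet p q := by
  by_contra hcon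
  push Not at hcon
  set s : Set ℤ := signedSet p ∩ permOrbit τ u with hs
  have hfin : s.Finite := ((Set.finite_Icc (-(p : ℤ)) p).subset (by
    intro x hx
    exact abs_le.1 hx.2)).subset Set.inter_subset_left
  have hst : Set.MapsTo τ s s := by
    rintro x ⟨h1, h2⟩
    have h3 := hcon x h2 h1
    refine ⟨?_, ?_⟩
    · rcases ss_or.1 (inB_maps hτ (ss_or.2 (.inl h1))) with h | h
      · exact h
      · exact absurd h h3
    · obtain ⟨m, rfl⟩ := h2
      exact ⟨1 + m, by rw [zpow_add]; simp⟩
  have himg : τ '' s = s := Set.eq_of_subset_of_ncard_le hst.image_subset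
    (by rw [Set.ncard_image_of_injective _ τ.injective]) hfin
  have hinv : ∀ {x}, x ∈ s → τ⁻¹ x ∈ s := by
    intro x hx
    rw [← himg] at hx
    obtain ⟨y, hy, rfl⟩ := hx
    simpa using hy
  have hz : ∀ m : ℤ, (τ ^ m) u ∈ s := by
    intro m
    induction m using Int.induction_on with
    | zero => exact ⟨hu, 0, by simp⟩
    | succ k ih =>
      have := hst ih
      rw [← Equiv.Perm.mul_apply, ← zpow_one_add] at this
      rwa [add_comm]
    | pred k ih =>
      have := hinv ih
      rw [← Equiv.Perm.mul_apply, ← zpow_neg_one, ← zpow_add] at this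
      rwa [show (-(k : ℤ) - 1) = -1 + -k by ring]
  obtain ⟨m, rfl⟩ := huv
  exact ss_disj (hz m).1 hv

theorem cross_aux {p q : ℕ} {τ d x x' u v} (hp : 1 ≤ p) (hq : 1 ≤ q) (hd : d.Pairwise (rel p q)) (hc : Cyc τ d)
    (e : d = u ++ x :: v) (hv : x' ∈ v) (hx' : x' ∈ signedSet p)
    (hy : τ x ∈ innerSet p q) : False := by
  subst e
  rcases v with _ | ⟨y, v⟩
  · simp at hv
  have hxy := Ch_next hc.1
  rw [hxy] at hy
  rcases List.mem_cons.1 hv with rfl | h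
  · exact ss_disj hx' hy
  · have h1 := (List.pairwise_cons.1 (List.pairwise_cons.1 (List.pairwise_append.1 hd).2.1).2).1 x' h
    exact rel_asymm hp hq _ _ h1 (.inl ⟨hx', hy⟩)

theorem cross_uniq {p q : ℕ} {τ d x x'} (hp : 1 ≤ p) (hq : 1 ≤ q) (hd : d.Pairwise (rel p q)) (hc : Cyc τ d)
    (h : x ∈ d) (h' : x' ∈ d) (hx : x ∈ signedSet p) (hx' : x' ∈ signedSet p)
    (hy : τ x ∈ innerSet p q) (hy' : τ x' ∈ innerSet p q) : x = x' := by
  obtain ⟨u, v, e⟩ := List.append_of_mem h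
  rw [e] at h'
  rcases List.mem_append.1 h' with h1 | h1
  · obtain ⟨u1, u2, rfl⟩ := List.append_of_mem h1
    exact (cross_aux hp hq hd hc (x := x') (x' := x) (u := u1) (v := u2 ++ x :: v) (by simp [e]) (by simp) hx hy').elim
  · rcases List.mem_cons.1 h1 with h1 | h1
    · exact h1.symm
    · exact (cross_aux hp hq hd hc e h1 hx' hy).elim

theorem negSet_negSet (A : Set ℤ) : negSet (negSet A) = A := by ext x; simp [negSet]

theorem ot_orb {n τ A} (h : A ∈ omegaTilde n τ) (h' : negSet A ≠ A) : A ∈ orbitsOn n τ := by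
  rcases h with h | ⟨rfl, -⟩
  · exact h.1
  · exfalso
    apply h'
    ext x
    constructor
    · rintro ⟨B, ⟨h1, h2⟩, hx⟩
      refine ⟨B, ⟨h1, h2⟩, ?_⟩
      rw [← h2]; exact hx
    · rintro ⟨B, ⟨h1, h2⟩, hx⟩
      refine ⟨B, ⟨h1, h2⟩, ?_⟩
      rw [← h2] at hx; exact hx

def Tt (p q c e i : ℕ) : Set (Equiv.Perm ℤ) :=
  {τ | τ ∈ SncB p q ∧ connectivity p q (omegaTilde (p + q) τ) = c ∧
    extPairs p (omegaTilde (p + q) τ) = e ∧ intPairs p q (omegaTilde (p + q) τ) = i}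

theorem orb_eq {τ : Equiv.Perm ℤ} {x y} (h : y ∈ permOrbit τ x) : permOrbit τ y = permOrbit τ x := by
  obtain ⟨m, rfl⟩ := h
  ext z
  constructor
  · rintro ⟨k, rfl⟩; exact ⟨k + m, by rw [zpow_add]; rfl⟩
  · rintro ⟨k, rfl⟩; exact ⟨k - m, by rw [← Equiv.Perm.mul_apply, ← zpow_add]; simp⟩

theorem Tt_cross {p q c e i : ℕ} (hc : 1 ≤ c) {τ} (h : τ ∈ Tt p q c e i) :
    ∃ a < 2 * p, ∃ b < 2 * q, τ (cir 0 p a) = cir p q b := by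
  have hne : {A | A ∈ omegaTilde (p + q) τ ∧ negSet A ≠ A ∧ (A ∩ signedSet p).Nonempty ∧
      (A ∩ innerSet p q).Nonempty}.Nonempty := by
    by_contra h0
    rw [Set.not_nonempty_iff_eq_empty] at h0
    have := h.2.1
    unfold connectivity at this
    rw [h0, Set.ncard_empty] at this
    omega
  obtain ⟨A, h1, h2, ⟨u, hu, hu'⟩, v, hv, hv'⟩ := hne
  obtain ⟨x, hx, rfl⟩ := ot_orb h1 h2
  rw [← orb_eq hu] at hv
  obtain ⟨z, hz, hzp, hzq⟩ := exists_cross h.1.1 hu' hv' hv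
  obtain ⟨a, ha, rfl⟩ := cir_surj (sS_iff.1 hzp)
  obtain ⟨b, hb, e⟩ := cir_surj hzq
  exact ⟨a, ha, b, hb, e.symm⟩

open Classical in
theorem Tt_count {p q c e i : ℕ} (hp : 1 ≤ p) (hq : 1 ≤ q) (hc : 1 ≤ c) {τ} (h : τ ∈ Tt p q c e i) :
    ((Finset.range (2 * p) ×ˢ Finset.range (2 * q)).filter
      (fun ab => τ (cir 0 p ab.1) = cir p q ab.2)).card = 2 * c := by
  obtain ⟨a, ha, b, hb, hab⟩ := Tt_cross hc h
  obtain ⟨w, L, hR⟩ := Rr_fwd hp hq h.1 hab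
  have hR' := hR
  obtain ⟨w1, w2, Sm, L1, L2, rfl, r1, r2, rfl, f1, f2⟩ := hR.split
  obtain ⟨t1, -, -, -, t5⟩ := Rr.stats hp hq h.1.1 r1 r2 f1 f2 hR
  have hB := h.1.1
  rw [← t1, h.2.1] at t5
  rw [← t5, ← Set.ncard_coe_finset]
  have im : {A | A ∈ omegaTilde (p + q) τ ∧ negSet A ≠ A ∧ (A ∩ signedSet p).Nonempty ∧
      (A ∩ innerSet p q).Nonempty} = (fun ab : ℕ × ℕ => permOrbit τ (cir 0 p ab.1)) ''
      (((Finset.range (2 * p) ×ˢ Finset.range (2 * q)).filter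
      (fun ab => τ (cir 0 p ab.1) = cir p q ab.2) : Finset (ℕ × ℕ)) : Set (ℕ × ℕ)) := by
    ext A
    constructor
    · rintro ⟨h1, h2, ⟨u, hu, hu'⟩, v, hv, hv'⟩
      obtain ⟨x, hx, rfl⟩ := ot_orb h1 h2
      rw [← orb_eq hu] at hv
      obtain ⟨z, hz, hzp, hzq⟩ := exists_cross hB hu' hv' hv
      obtain ⟨a, ha, rfl⟩ := cir_surj (sS_iff.1 hzp)
      obtain ⟨b, hb, e⟩ := cir_surj hzq
      refine ⟨(a, b), ?_, ?_⟩
      · simp [ha, hb, e]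
      · rw [← orb_eq hu]
        exact orb_eq hz
    · rintro ⟨⟨a, b⟩, hab, rfl⟩
      simp only [Finset.coe_filter, Set.mem_ofPred_eq] at hab
      have hs : cir 0 p a ∈ signedSet (p + q) := ss_or.2 (.inl (cP_mem hp a))
      obtain ⟨d, h1, h2, h3, h4, -⟩ := hR'.good hp hq hB hs
      refine ⟨?_, good_neg h3 h1 h4, ⟨_, ⟨0, rfl⟩, cP_mem hp a⟩, ⟨cir p q b, ⟨1, by simpa using hab.2⟩, cQ_mem hq b⟩⟩
      rw [hR'.omega hp hq hB]
      exact ⟨_, hs, rfl⟩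
  rw [im, Set.InjOn.ncard_image]
  rintro ⟨a, b⟩ hab ⟨a', b'⟩ hab' heq
  simp only [Finset.coe_filter, Set.mem_ofPred_eq, Finset.mem_product, Finset.mem_range] at hab hab' heq
  have hs : cir 0 p a ∈ signedSet (p + q) := ss_or.2 (.inl (cP_mem hp a))
  obtain ⟨d, h1, h2, h3, h4, -⟩ := hR'.good hp hq hB hs
  have hm : cir 0 p a' ∈ permOrbit τ (cir 0 p a) := by rw [heq]; exact ⟨0, rfl⟩
  rw [Cyc_orbit h3 h1] at hm
  have ex := cross_uniq hp hq h2 h3 h1 hm (cP_mem hp a) (cP_mem hp a') (by rw [hab.2]; exact cQ_mem hq b)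
    (by rw [hab'.2]; exact cQ_mem hq b')
  have ey : cir p q b = cir p q b' := by rw [← hab.2, ← hab'.2, ex]
  have e1 := Nat.ModEq.eq_of_lt_of_lt (cir_inj hp ex) hab.1.1 hab'.1.1
  have e2 := Nat.ModEq.eq_of_lt_of_lt (cir_inj hq ey) hab.1.2 hab'.1.2
  rw [e1, e2]

open Classical in
theorem final_count (p q c e i : ℕ) (hp : 1 ≤ p) (hq : 1 ≤ q) (hc1 : 1 ≤ c) :
    {π | π ∈ NCB p q ∧ connectivity p q π = c ∧ extPairs p π = e ∧
        intPairs p q π = i}.ncard =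
      2 * c * Nat.choose p e * Nat.choose p (e + c) * Nat.choose q i *
        Nat.choose q (i + c) := by
  have im : {π | π ∈ NCB p q ∧ connectivity p q π = c ∧ extPairs p π = e ∧
        intPairs p q π = i} = omegaTilde (p + q) '' Tt p q c e i := by
    ext π
    constructor
    · rintro ⟨⟨τ, hτ, rfl⟩, h⟩
      exact ⟨τ, ⟨hτ, h⟩, rfl⟩
    · rintro ⟨τ, ⟨hτ, h⟩, rfl⟩
      exact ⟨⟨τ, hτ, rfl⟩, h⟩
  have inj : Set.InjOn (omegaTilde (p + q)) (Tt p q c e i) := by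
    intro τ h τ' h' heq
    obtain ⟨a, ha, b, hb, hab⟩ := Tt_cross hc1 h
    obtain ⟨w, L, hR⟩ := Rr_fwd hp hq h.1 hab
    obtain ⟨a', ha', b', hb', hab'⟩ := Tt_cross hc1 h'
    obtain ⟨w', L', hR'⟩ := Rr_fwd hp hq h'.1 hab'
    exact hR.inj hp hq h.1.1 hR' h'.1.1 heq
  rw [im, Set.InjOn.ncard_image inj]
  have fin : (Tt p q c e i).Finite := by
    have : (⋃ ab ∈ ((Finset.range (2 * p) ×ˢ Finset.range (2 * q) : Finset (ℕ × ℕ)) : Set (ℕ × ℕ)),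
        Tab p q c e i ab.1 ab.2).Finite :=
      Set.Finite.biUnion (Finset.finite_toSet _) fun ab _ => (Tab_card c e i ab.1 ab.2 hp hq).1
    refine this.subset ?_
    intro τ h
    obtain ⟨a, ha, b, hb, hab⟩ := Tt_cross hc1 h
    refine Set.mem_biUnion (x := (a, b)) (by simp [ha, hb]) ?_
    exact ⟨h, hab⟩
  have key := Finset.card_mul_eq_card_mul (s := fin.toFinset) (t := Finset.range (2 * p) ×ˢ Finset.range (2 * q))
    (fun (τ : Equiv.Perm ℤ) (ab : ℕ × ℕ) => τ (cir 0 p ab.1) = cir p q ab.2) (m := 2 * c)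
    (n := (Hw p c e).card * (Hw q c i).card) (by
      intro τ hτ
      exact Tt_count hp hq hc1 (fin.mem_toFinset.1 hτ)) (by
      intro ab _
      rw [← (Tab_card c e i ab.1 ab.2 hp hq).2, ← Set.ncard_coe_finset]
      congr 1
      ext τ
      simp [Finset.bipartiteBelow, Tab, Tt]
      tauto)
  rw [Finset.card_product, Finset.card_range, Finset.card_range, ← Set.ncard_eq_toFinset_card _ fin] at key
  have k1 := Hw_card p c e hp hc1
  have k2 := Hw_card q c i hq hc1
  refine Nat.eq_of_mul_eq_mul_right (show 0 < 2 * c by omega) ?_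
  rw [key]
  calc 2 * p * (2 * q) * ((Hw p c e).card * (Hw q c i).card)
      = 4 * (p * (Hw p c e).card) * (q * (Hw q c i).card) := by ring
    _ = _ := by rw [k1, k2]; ring

/-- For `1 ≤ c ≤ min{p,q}`, `0 ≤ e ≤ p-c`, `0 ≤ i ≤ q-c`, the number of
partitions in `NC^B(p,q)` with connectivity `c`, `e` exterior pairs of blocks and
`i` interior pairs of blocks is `2c·C(p,e)·C(p,e+c)·C(q,i)·C(q,i+c)`. -/
theorem ncb_conn_ext_int_card (p q c e i : ℕ) (hp : 1 ≤ p) (hq : 1 ≤ q)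
    (hc1 : 1 ≤ c) (hcp : c ≤ p) (hcq : c ≤ q) (he : e ≤ p - c) (hi : i ≤ q - c) :
    {π | π ∈ NCB p q ∧ connectivity p q π = c ∧ extPairs p π = e ∧
        intPairs p q π = i}.ncard =
      2 * c * Nat.choose p e * Nat.choose p (e + c) * Nat.choose q i *
        Nat.choose q (i + c) := by
  exact final_count p q c e i hp hq hc1
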